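/- arXiv:0904.2477 — 10 statements merged into one kernel-verified Lean document; each statement's English description precedes it below -/
import Mathlib

section
/- Let ℓ ≥ 1, let 0 < x_1 ≤ x_2 ≤ ⋯ ≤ x_ℓ be real numbers and let β_1 < β_2 < ⋯ < β_ℓ be real numbers. Then the generalized Vandermonde determinant det((x_j^{β_i})_{i,j=1,…,ℓ}) is non-negative, and it equals zero if and only if there exists j ∈ {1, 2, …, ℓ−1} such that x_j = x_{j+1} (in particular, it is strictly positive when x_1 < x_2 < ⋯ < x_ℓ). -/
open Real Filter

/-- A generalized polynomial with `n + 1` real exponents, positive leading coefficient and `n`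
distinct positive zeros is positive to the right of these zeros. -/
theorem sum_mul_rpow_pos_of_zeros_lt (n : ℕ) :
    ∀ (c β : Fin (n + 1) → ℝ) (x : Fin n → ℝ), StrictMono β → StrictMono x → (∀ j, 0 < x j) →
      0 < c (Fin.last n) → (∀ j, ∑ i, c i * x j ^ β i = 0) →
      ∀ t, 0 < t → (∀ j, x j < t) → 0 < ∑ i, c i * t ^ β i := by
  induction n with
  | zero =>
    intro c β x _ _ _ hc _ t ht _
    simpa using mul_pos hc (rpow_pos_of_pos ht _)
  | succ n ih =>
    intro c β x hβ hxm hx hc hz t ht hxt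
    set g : ℝ → ℝ := fun s => ∑ i, c i * s ^ (β i - β 0) with hg
    set g' : ℝ → ℝ := fun s =>
      ∑ i : Fin (n + 1), (c i.succ * (β i.succ - β 0)) * s ^ (β i.succ - β 0 - 1) with hg'
    have hfg (s : ℝ) (hs : 0 < s) : ∑ i, c i * s ^ β i = s ^ β 0 * g s := by
      rw [hg, Finset.mul_sum]
      refine Finset.sum_congr rfl fun i _ => ?_
      rw [mul_left_comm, ← rpow_add hs, add_sub_cancel]
    have hgd (s : ℝ) (hs : 0 < s) : HasDerivAt g (g' s) s := by
      have h : HasDerivAt g (∑ i, c i * ((β i - β 0) * s ^ (β i - β 0 - 1))) s :=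
        HasDerivAt.fun_sum fun i _ =>
          (Real.hasDerivAt_rpow_const (Or.inl hs.ne')).const_mul (c i)
      convert h using 1
      rw [Fin.sum_univ_succ]
      simp [hg', mul_assoc]
    have hgz (j : Fin (n + 1)) : g (x j) = 0 := by
      have h := hz j
      rw [hfg _ (hx j)] at h
      exact (mul_eq_zero.1 h).resolve_left (rpow_pos_of_pos (hx j) _).ne'
    have hrolle (j : Fin n) : ∃ y ∈ Set.Ioo (x j.castSucc) (x j.succ), g' y = 0 :=
      exists_hasDerivAt_eq_zero (hxm j.castSucc_lt_succ)
        (fun s hs => (hgd s ((hx _).trans_le hs.1)).continuousAt.continuousWithinAt)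
        ((hgz _).trans (hgz _).symm) fun s hs => hgd s ((hx _).trans hs.1)
    choose y hy hyz using hrolle
    have hym : StrictMono y := fun j k hjk =>
      ((hy j).2.trans_le (hxm.monotone (Fin.succ_le_castSucc_iff.2 hjk))).trans (hy k).1
    have hpos (s : ℝ) (hs : x (Fin.last n) ≤ s) : 0 < g' s :=
      ih _ (fun i => β i.succ - β 0 - 1) y
        (fun i j hij => by
          have := hβ (Fin.succ_lt_succ_iff.2 hij)
          dsimp only
          linarith)
        hym (fun j => (hx _).trans (hy j).1)
        (mul_pos hc (sub_pos.2 (hβ (Fin.succ_pos _)))) hyz s ((hx _).trans_le hs)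
        fun j => (hy j).2.trans_le ((hxm.monotone (Fin.le_last _)).trans hs)
    have hmono : StrictMonoOn g (Set.Ici (x (Fin.last n))) := by
      refine strictMonoOn_of_deriv_pos (convex_Ici _)
        (fun s hs => (hgd s ((hx _).trans_le hs)).continuousAt.continuousWithinAt) fun s hs => ?_
      have hs' := interior_subset hs
      rw [(hgd s ((hx _).trans_le hs')).deriv]
      exact hpos s hs'
    have hgt : 0 < g t := by
      have h := hmono (Set.mem_Ici.2 le_rfl) (Set.mem_Ici.2 (hxt _).le) (hxt (Fin.last n))
      rwa [hgz] at h
    rw [hfg t ht]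
    exact mul_pos (rpow_pos_of_pos ht _) hgt

/-- Generalized Vandermonde determinants with increasing nodes and exponents are positive. -/
theorem generalized_vandermonde_det_pos (n : ℕ) :
    ∀ x β : Fin n → ℝ, (∀ i, 0 < x i) → StrictMono x → StrictMono β →
      0 < (Matrix.of fun i j : Fin n => x j ^ β i).det := by
  induction n with
  | zero => intros; simp
  | succ n ih =>
    intro x β hx hxm hβ
    set c : Fin (n + 1) → ℝ := fun i => (-1) ^ ((i : ℕ) + n) *
      (Matrix.of fun k j : Fin n => x j.castSucc ^ β (i.succAbove k)).det with hc
    have hdet (t : ℝ) : (Matrix.of fun i j : Fin (n + 1) =>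
        (Fin.snoc (fun j : Fin n => x j.castSucc) t : Fin (n + 1) → ℝ) j ^ β i).det =
          ∑ i, c i * t ^ β i := by
      rw [Matrix.det_succ_column _ (Fin.last n)]
      refine Finset.sum_congr rfl fun i _ => ?_
      simp only [hc, Matrix.of_apply, Fin.snoc_last, Fin.val_last]
      rw [mul_right_comm]
      congr 3
      ext k j
      simp
    have hlast := hdet (x (Fin.last n))
    have hsnoc : (Fin.snoc (fun j : Fin n => x j.castSucc) (x (Fin.last n)) : Fin (n + 1) → ℝ) = x :=
      Fin.snoc_init_self x
    rw [hsnoc] at hlast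
    rw [hlast]
    refine sum_mul_rpow_pos_of_zeros_lt n c β (fun j => x j.castSucc) hβ
      (fun i j hij => hxm (Fin.castSucc_lt_castSucc_iff.2 hij)) (fun j => hx _) ?_ (fun j => ?_) _
      (hx _) fun j => hxm (Fin.castSucc_lt_last j)
    · have h := ih (fun j => x j.castSucc) (fun i => β i.castSucc) (fun j => hx _)
        (fun i j hij => hxm (Fin.castSucc_lt_castSucc_iff.2 hij))
        (fun i j hij => hβ (Fin.castSucc_lt_castSucc_iff.2 hij))
      simpa [hc, ← two_mul] using h
    · rw [← hdet]
      exact Matrix.det_zero_of_column_eq (Fin.castSucc_lt_last j).ne fun i => by simp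

theorem generalized_vandermonde_nonneg
    (ℓ : ℕ) (hℓ : 1 ≤ ℓ) (x β : Fin ℓ → ℝ)
    (hx : ∀ i, 0 < x i) (hxm : Monotone x) (hβ : StrictMono β) :
    0 ≤ (Matrix.of fun i j : Fin ℓ => x j ^ β i).det ∧
      ((Matrix.of fun i j : Fin ℓ => x j ^ β i).det = 0 ↔
        ∃ j : ℕ, ∃ hj : j + 1 < ℓ,
          x ⟨j, Nat.lt_of_succ_lt hj⟩ = x ⟨j + 1, hj⟩) := by
  by_cases h : ∃ j : ℕ, ∃ hj : j + 1 < ℓ, x ⟨j, Nat.lt_of_succ_lt hj⟩ = x ⟨j + 1, hj⟩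
  · have hdet : (Matrix.of fun i j : Fin ℓ => x j ^ β i).det = 0 := by
      obtain ⟨j, hj, hxj⟩ := h
      refine Matrix.det_zero_of_column_eq (i := ⟨j, Nat.lt_of_succ_lt hj⟩) (j := ⟨j + 1, hj⟩)
        (by simp) fun i => ?_
      simp [hxj]
    exact ⟨hdet.ge, iff_of_true hdet h⟩
  · have hxs : StrictMono x := by
      obtain ⟨n, rfl⟩ := Nat.exists_eq_add_of_le' hℓ
      refine Fin.strictMono_iff_lt_succ.2 fun i => ?_
      exact (hxm i.castSucc_lt_succ.le).lt_of_ne fun hi =>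
        h ⟨i, Nat.succ_lt_succ i.isLt, hi⟩
    have hdet := generalized_vandermonde_det_pos ℓ x β hx hxs hβ
    exact ⟨hdet.le, iff_of_false hdet.ne' h⟩
end

section
/- Let m ≥ 1, let 0 < α_1 < α_2 < ⋯ < α_m with α_i ≠ 1 for all i, let n ≥ m+1, and let p = (p_1, …, p_n) be a probability vector on n points with 0 < p_1 < p_2 < ⋯ < p_{m+1}. Let A be the (m+1)×(m+1) real matrix with entries A_{i,j} = (α_i/(1−α_i))·p_j^{α_i−1}/(∑_{r=1}^n p_r^{α_i}) for 1 ≤ i ≤ m and 1 ≤ j ≤ m+1, and A_{m+1,j} = 1 for 1 ≤ j ≤ m+1. Then det A > 0. -/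
open Real Filter

theorem exponential_sum_eq_zero_of_zeros :
    ∀ (N : ℕ) (a c t : Fin N → ℝ), Function.Injective a → StrictMono t →
      (∀ j, ∑ i, c i * exp (a i * t j) = 0) → c = 0 := by
  intro N
  induction N with
  | zero => intro a c t _ _ _; exact Subsingleton.elim _ _
  | succ N ih =>
    intro a c t ha ht h
    set b := a (Fin.last N) with hb
    set g : ℝ → ℝ := fun s => ∑ i, c i * exp ((a i - b) * s) with hg
    have hg0 : ∀ j, g (t j) = 0 := by
      intro j
      have : g (t j) = exp (-b * t j) * ∑ i, c i * exp (a i * t j) := by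
        simp only [hg, Finset.mul_sum]
        refine Finset.sum_congr rfl fun i _ => ?_
        rw [mul_left_comm, ← exp_add]
        ring_nf
      rw [this, h j, mul_zero]
    have hderiv : ∀ s, HasDerivAt g (∑ i, c i * (exp ((a i - b) * s) * (a i - b))) s := by
      intro s
      refine HasDerivAt.fun_sum fun i _ => ?_
      simpa using (((hasDerivAt_id s).const_mul (a i - b)).exp).const_mul (c i)
    have hrolle : ∀ j : Fin N, ∃ s ∈ Set.Ioo (t j.castSucc) (t j.succ),
        ∑ i, c i * (exp ((a i - b) * s) * (a i - b)) = 0 := fun j =>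
      exists_hasDerivAt_eq_zero (ht j.castSucc_lt_succ)
        (fun s _ => (hderiv s).continuousAt.continuousWithinAt)
        ((hg0 _).trans (hg0 _).symm) fun s _ => hderiv s
    choose u hu hu0 using hrolle
    have hu_mono : StrictMono u := by
      intro i j hij
      refine (hu i).2.trans_le (le_trans (ht.monotone ?_) (hu j).1.le)
      exact Fin.succ_le_castSucc_iff.2 hij
    have hinit := ih (fun i => a i.castSucc - b) (fun i => c i.castSucc * (a i.castSucc - b)) u
      (fun i j hij => Fin.castSucc_injective N (ha (sub_left_injective hij))) hu_mono
      (fun j => by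
        have := hu0 j
        rw [Fin.sum_univ_castSucc] at this
        simp only [← hb, sub_self, mul_zero, add_zero] at this
        rw [← this]
        exact Finset.sum_congr rfl fun i _ => by ring)
    have hc : ∀ i : Fin N, c i.castSucc = 0 := fun i =>
      (mul_eq_zero.1 (congrFun hinit i)).resolve_right
        (sub_ne_zero.2 (ha.ne (Fin.castSucc_lt_last i).ne))
    funext i
    refine Fin.lastCases ?_ hc i
    have := h 0
    rw [Fin.sum_univ_castSucc] at this
    simpa [hc, (exp_pos _).ne'] using this

theorem det_exp_mul_ne_zero {N : ℕ} {a t : Fin N → ℝ} (ha : Function.Injective a)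
    (ht : StrictMono t) : (Matrix.of fun i j => exp (a i * t j)).det ≠ 0 := by
  intro h
  obtain ⟨c, hc, hc0⟩ := Matrix.exists_vecMul_eq_zero_iff.2 h
  exact hc (exponential_sum_eq_zero_of_zeros N a c t ha ht fun j => congrFun hc0 j)

theorem det_exp_mul_pos :
    ∀ (N : ℕ) (a t : Fin N → ℝ), StrictMono a → StrictMono t →
      0 < (Matrix.of fun i j => exp (a i * t j)).det := by
  intro N
  induction N with
  | zero => intro a t _ _; simp
  | succ N ih =>
    intro a t ha ht
    set D : ℝ → ℝ := fun s =>
      (Matrix.of fun i j => exp (a i * Function.update t (Fin.last N) s j)).det with hD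
    set c : Fin (N + 1) → ℝ := fun i => (-1) ^ ((i : ℕ) + N) *
      (Matrix.of fun k l : Fin N => exp (a (i.succAbove k) * t l.castSucc)).det with hc
    have hDsum : ∀ s, D s = ∑ i, c i * exp (a i * s) := by
      intro s
      simp only [hD]
      rw [Matrix.det_succ_column _ (Fin.last N)]
      refine Finset.sum_congr rfl fun i _ => ?_
      have hsub : (Matrix.of fun i j => exp (a i * Function.update t (Fin.last N) s j)).submatrix
          i.succAbove (Fin.last N).succAbove =
          Matrix.of fun k l : Fin N => exp (a (i.succAbove k) * t l.castSucc) := by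
        ext k l
        simp
      rw [hsub]
      simp only [hc, Matrix.of_apply, Function.update_self, Fin.val_last]
      ring
    have hcpos : 0 < c (Fin.last N) := by
      have := ih (fun k => a k.castSucc) (fun l => t l.castSucc)
        (ha.comp Fin.strictMono_castSucc) (ht.comp Fin.strictMono_castSucc)
      simpa [hc, ← two_mul] using this
    have hlim : Tendsto (fun s => ∑ i, c i * exp ((a i - a (Fin.last N)) * s)) atTop
        (nhds (c (Fin.last N))) := by
      simp only [Fin.sum_univ_castSucc (n := N), sub_self, zero_mul, exp_zero, mul_one]
      have : Tendsto (fun s => ∑ i : Fin N, c i.castSucc *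
          exp ((a i.castSucc - a (Fin.last N)) * s)) atTop (nhds (∑ i : Fin N, c i.castSucc * 0)) :=
        tendsto_finsetSum _ fun i _ => (tendsto_exp_atBot.comp
          (tendsto_id.const_mul_atTop_of_neg
            (sub_neg.2 (ha (Fin.castSucc_lt_last i))))).const_mul _
      simpa using this.add_const (c (Fin.last N))
    obtain ⟨s, hs, hts⟩ := ((hlim.eventually_const_lt hcpos).and
      (eventually_ge_atTop (t (Fin.last N)))).exists
    have hDs : 0 < D s := by
      have : D s = exp (a (Fin.last N) * s) *
          ∑ i, c i * exp ((a i - a (Fin.last N)) * s) := by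
        rw [hDsum, Finset.mul_sum]
        refine Finset.sum_congr rfl fun i _ => ?_
        rw [mul_left_comm, ← exp_add]
        ring_nf
      rw [this]
      exact mul_pos (exp_pos _) hs
    have hDcont : Continuous D := by
      rw [funext hDsum]
      fun_prop
    have hDne : ∀ r, t (Fin.last N) ≤ r → D r ≠ 0 := by
      intro r hr
      refine det_exp_mul_ne_zero ha.injective fun i j hij => ?_
      have hi : i ≠ Fin.last N := (hij.trans_le (Fin.le_last j)).ne
      rw [Function.update_of_ne hi]
      rcases eq_or_ne j (Fin.last N) with rfl | hj
      · rw [Function.update_self]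
        exact (ht hij).trans_le hr
      · rw [Function.update_of_ne hj]
        exact ht hij
    have hDt : D (t (Fin.last N)) = (Matrix.of fun i j => exp (a i * t j)).det := by
      simp only [hD, Function.update_eq_self]
    rw [← hDt]
    by_contra! hle
    obtain ⟨r, hr, hr0⟩ := intermediate_value_Icc hts hDcont.continuousOn ⟨hle, hDs.le⟩
    exact hDne r hr.1 hr0

theorem det_exp_mul_mul_det_vandermonde_pos {N : ℕ} {a t : Fin N → ℝ}
    (ha : Function.Injective a) (ht : StrictMono t) :
    0 < (Matrix.of fun i j => exp (a i * t j)).det * (Matrix.vandermonde a).det := by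
  set σ := Tuple.sort a
  have hσ : StrictMono (a ∘ σ) :=
    (Tuple.monotone_sort a).strictMono_of_injective (ha.comp σ.injective)
  have hE := det_exp_mul_pos N (a ∘ σ) t hσ ht
  have hV : 0 < (Matrix.vandermonde (a ∘ σ)).det := by
    rw [Matrix.det_vandermonde]
    exact Finset.prod_pos fun i _ => Finset.prod_pos fun j hj =>
      sub_pos.2 (hσ (Finset.mem_Ioi.1 hj))
  have hE' := Matrix.det_permute σ (Matrix.of fun i j => exp (a i * t j))
  have hV' := Matrix.det_permute σ (Matrix.vandermonde a)
  have hsign : ((Equiv.Perm.sign σ : ℤ) : ℝ) * ((Equiv.Perm.sign σ : ℤ) : ℝ) = 1 := by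
    exact_mod_cast Int.units_coe_mul_self (Equiv.Perm.sign σ)
  have hprod := mul_pos hE hV
  change 0 < ((Matrix.of fun i j => exp (a i * t j)).submatrix σ id).det *
    ((Matrix.vandermonde a).submatrix σ id).det at hprod
  rwa [hE', hV', mul_mul_mul_comm, hsign, one_mul] at hprod

theorem det_partial_derivatives_pos
    (m n : ℕ) (hm : 1 ≤ m) (α : Fin m → ℝ)
    (hα0 : ∀ i, 0 < α i) (hαm : StrictMono α) (hα1 : ∀ i, α i ≠ 1)
    (hn : m + 1 ≤ n) (p : Fin n → ℝ)
    (hp : ∀ i, 0 ≤ p i) (hps : ∑ i, p i = 1)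
    (hpos : 0 < p (Fin.castLE hn 0))
    (hinc : StrictMono fun j : Fin (m + 1) => p (Fin.castLE hn j)) :
    0 < (Matrix.of fun i j : Fin (m + 1) =>
      if h : (i : ℕ) < m then
        (α ⟨i, h⟩ / (1 - α ⟨i, h⟩)) *
          ((p (Fin.castLE hn j)) ^ (α ⟨i, h⟩ - 1) / ∑ r, (p r) ^ (α ⟨i, h⟩))
      else 1).det := by
  have hpj : ∀ j : Fin (m + 1), 0 < p (Fin.castLE hn j) := fun j =>
    hpos.trans_le (hinc.monotone (Fin.zero_le j))
  have hS : ∀ i, 0 < ∑ r, p r ^ α i := fun i =>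
    Finset.sum_pos' (fun r _ => rpow_nonneg (hp r) _)
      ⟨Fin.castLE hn 0, Finset.mem_univ _, rpow_pos_of_pos hpos _⟩
  set a : Fin (m + 1) → ℝ := Fin.snoc (fun i => α i - 1) 0 with ha
  set d : Fin (m + 1) → ℝ :=
    Fin.snoc (fun i => α i / (1 - α i) / ∑ r, p r ^ α i) 1 with hd
  have ha_inj : Function.Injective a := by
    refine Fin.snoc_injective_iff.2 ⟨fun i j hij => hαm.injective (sub_left_injective hij), ?_⟩
    rintro ⟨i, hi⟩
    exact hα1 i (sub_eq_zero.1 hi)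
  have ht : StrictMono fun j : Fin (m + 1) => log (p (Fin.castLE hn j)) :=
    fun i j hij => log_lt_log (hpj i) (hinc hij)
  have hfactor : (Matrix.of fun i j : Fin (m + 1) =>
      if h : (i : ℕ) < m then
        (α ⟨i, h⟩ / (1 - α ⟨i, h⟩)) *
          ((p (Fin.castLE hn j)) ^ (α ⟨i, h⟩ - 1) / ∑ r, (p r) ^ (α ⟨i, h⟩))
      else 1) = Matrix.of fun i j => d i *
        (Matrix.of fun i j : Fin (m + 1) => exp (a i * log (p (Fin.castLE hn j)))) i j := by
    ext i j
    refine Fin.lastCases ?_ (fun i => ?_) i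
    · simp [ha, hd]
    · simp only [ha, hd, Matrix.of_apply, Fin.snoc_castSucc, Fin.val_castSucc, i.isLt, dif_pos,
        Fin.eta, rpow_def_of_pos (hpj j)]
      rw [mul_comm (log _)]
      ring
  have hdV : 0 < (∏ i, d i) * (Matrix.vandermonde a).det := by
    rw [Matrix.det_vandermonde, ← Finset.prod_mul_distrib]
    refine Finset.prod_pos fun i _ => ?_
    refine Fin.lastCases ?_ (fun i => ?_) i
    · have : Finset.Ioi (Fin.last m) = ∅ := Finset.Ioi_eq_empty.2 isMax_top
      simp [hd, this]
    · rw [← Finset.mul_prod_erase _ _ (Finset.mem_Ioi.2 (Fin.castSucc_lt_last i)), ← mul_assoc]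
      refine mul_pos ?_ (Finset.prod_pos fun j hj => ?_)
      · have h1 : 1 - α i ≠ 0 := sub_ne_zero.2 (hα1 i).symm
        have : d i.castSucc * (a (Fin.last m) - a i.castSucc) = α i / ∑ r, p r ^ α i := by
          simp only [ha, hd, Fin.snoc_castSucc, Fin.snoc_last]
          have := (hS i).ne'
          field_simp
          ring
        rw [this]
        exact div_pos (hα0 i) (hS i)
      · obtain ⟨hj, hij⟩ := Finset.mem_erase.1 hj
        obtain ⟨k, rfl⟩ := Fin.exists_castSucc_eq.2 hj
        have hik : i < k := Fin.castSucc_lt_castSucc_iff.1 (Finset.mem_Ioi.1 hij)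
        simpa [ha] using hαm hik
  rw [hfactor, Matrix.det_mul_column]
  have hEV := det_exp_mul_mul_det_vandermonde_pos ha_inj ht
  have := mul_pos hdV hEV
  rw [mul_mul_mul_comm] at this
  exact pos_of_mul_pos_left this (mul_self_nonneg _)
end

section
/- Let m ≥ 1 and let 0 < α_1 < α_2 < ⋯ < α_m be real numbers. Let n ≥ m+2 and let P be a probability vector on n points whose coordinates take at least m+1 pairwise distinct strictly positive values. Then the point (H_{α_1}(P), H_{α_2}(P), …, H_{α_m}(P)) ∈ ℝ^m lies in the interior of the set { (H_{α_1}(Q), …, H_{α_m}(Q)) : Q a probability vector on n points }. -/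
open Real Filter

/-- Rényi entropy of order `α` of a vector `p` on `n` points (order 1 = Shannon entropy). -/
noncomputable def renyiH {n : ℕ} (α : ℝ) (p : Fin n → ℝ) : ℝ :=
  if α = 1 then -∑ i, p i * Real.log (p i)
  else (1 / (1 - α)) * Real.log (∑ i, p i ^ α)

/-- `unif n k` : probability vector on `n` points with `k` coordinates equal to `1/k`
and the remaining coordinates equal to `0`. -/
noncomputable def unif (n k : ℕ) : Fin n → ℝ :=
  fun i => if (i : ℕ) < k then (k : ℝ)⁻¹ else 0

/-- By Rolle's theorem, a differentiable function with finitely many zeros `Z` has a derivative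
vanishing at `Z.card - 1` points or more. -/
theorem exists_finset_deriv_zeros {f f' : ℝ → ℝ} (hf : ∀ x, HasDerivAt f (f' x) x)
    (Z : Finset ℝ) (hZ : ∀ z ∈ Z, f z = 0) :
    ∃ W : Finset ℝ, (∀ w ∈ W, f' w = 0) ∧ Z.card ≤ W.card + 1 := by
  have rolle : ∀ x y : ℝ, ∃ w, x ∈ Z → y ∈ Z → x < y → x < w ∧ w < y ∧ f' w = 0 := by
    intro x y
    by_cases h : x ∈ Z ∧ y ∈ Z ∧ x < y
    · obtain ⟨hx, hy, hxy⟩ := h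
      obtain ⟨w, hw, hw0⟩ := exists_hasDerivAt_eq_zero hxy
        (fun t _ => (hf t).continuousAt.continuousWithinAt) ((hZ x hx).trans (hZ y hy).symm)
        (fun t _ => hf t)
      exact ⟨w, fun _ _ _ => ⟨hw.1, hw.2, hw0⟩⟩
    · exact ⟨0, fun hx hy hxy => absurd ⟨hx, hy, hxy⟩ h⟩
  choose w hw using rolle
  refine ⟨((Z ×ˢ Z).image fun q => w q.1 q.2).filter fun t => f' t = 0,
    fun t ht => (Finset.mem_filter.1 ht).2, Finset.card_le_of_interleaved ?_⟩
  intro x hx y hy hxy _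
  obtain ⟨h1, h2, h3⟩ := hw x y hx hy hxy
  exact ⟨w x y, Finset.mem_filter.2
    ⟨Finset.mem_image.2 ⟨(x, y), Finset.mk_mem_product hx hy, rfl⟩, h3⟩, h1, h2⟩

/-- A real exponential sum with distinct exponents and at least as many zeros as terms is trivial. -/
theorem exp_sum_coeff_eq_zero {ι : Type*} (S : Finset ι) (β : ι → ℝ) (hβ : Set.InjOn β S) :
    ∀ (c : ι → ℝ) (Z : Finset ℝ), (∀ z ∈ Z, ∑ i ∈ S, c i * Real.exp (β i * z) = 0) →
      S.card ≤ Z.card → ∀ i ∈ S, c i = 0 := by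
  classical
  induction S using Finset.induction_on with
  | empty => simp
  | insert b S hb ih =>
    intro c Z hZ hcard
    rw [Finset.card_insert_of_notMem hb] at hcard
    have hzero : ∀ z ∈ Z, ∑ i ∈ insert b S, c i * Real.exp ((β i - β b) * z) = 0 := by
      intro z hz
      have h := congrArg (· * Real.exp (-(β b * z))) (hZ z hz)
      simp only [Finset.sum_mul, zero_mul] at h
      rw [← h]
      refine Finset.sum_congr rfl fun i _ => ?_
      rw [mul_assoc, ← Real.exp_add]
      ring_nf
    have hder : ∀ z, HasDerivAt (fun z => ∑ i ∈ insert b S, c i * Real.exp ((β i - β b) * z))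
        (∑ i ∈ insert b S, c i * (Real.exp ((β i - β b) * z) * (β i - β b))) z := by
      intro z
      refine HasDerivAt.fun_sum fun i _ => ?_
      simpa using (((hasDerivAt_id z).const_mul (β i - β b)).exp.const_mul (c i))
    obtain ⟨W, hW, hWcard⟩ := exists_finset_deriv_zeros hder Z hzero
    have hS := ih (hβ.mono (by simp)) (fun i => c i * (β i - β b)) W
      (fun w hw => by
        have h := congrArg (· * Real.exp (β b * w)) (hW w hw)
        simp only [Finset.sum_insert hb, sub_self, mul_zero, zero_add, Finset.sum_mul,
          zero_mul] at h
        rw [← h]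
        refine Finset.sum_congr rfl fun i _ => ?_
        rw [show β i * w = (β i - β b) * w + β b * w by ring, Real.exp_add]
        ring)
      (by omega)
    have hS' : ∀ i ∈ S, c i = 0 := by
      intro i hi
      refine (mul_eq_zero.1 (hS i hi)).resolve_right fun h => hb ?_
      have : i = b := hβ (by simp [hi]) (by simp) (sub_eq_zero.1 h)
      exact this ▸ hi
    obtain ⟨z, hz⟩ : Z.Nonempty := Finset.card_pos.1 (by omega)
    have hcb := hzero z hz
    rw [Finset.sum_insert hb, Finset.sum_eq_zero fun i hi => by rw [hS' i hi, zero_mul]] at hcb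
    intro i hi
    rcases Finset.mem_insert.1 hi with rfl | hi
    · simpa using hcb
    · exact hS' i hi

/-- Up to a nonzero factor, the derivative of `renyiH α` along a coordinate equal to `x`. -/
noncomputable def renyiSlope (α x : ℝ) : ℝ :=
  if α = 1 then Real.log x + 1 else x ^ (α - 1)

/-- Constants and the slopes of distinct orders form a Chebyshev system on the positive axis. -/
theorem renyiSlope_independent {m : ℕ} {α : Fin m → ℝ} (hα : Function.Injective α)
    {x : Fin (m + 1) → ℝ} (hx0 : ∀ j, 0 < x j) (hx : Function.Injective x) (a : ℝ) (c : Fin m → ℝ)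
    (h : ∀ j, a + ∑ i, c i * renyiSlope (α i) (x j) = 0) : a = 0 ∧ ∀ i, c i = 0 := by
  classical
  have hslope : ∀ i s, HasDerivAt (fun s => renyiSlope (α i) (Real.exp s))
      ((if α i = 1 then 1 else α i - 1) * Real.exp ((α i - 1) * s)) s := by
    intro i s
    unfold renyiSlope
    by_cases h1 : α i = 1
    · simpa [h1] using (hasDerivAt_id s).add_const 1
    · simp only [h1, if_false, ← Real.exp_mul]
      have := ((hasDerivAt_id s).mul_const (α i - 1)).exp
      simp only [id, one_mul] at this
      rw [mul_comm (α i - 1) s, mul_comm (α i - 1)]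
      exact this
  have hder : ∀ s, HasDerivAt (fun s => a + ∑ i, c i * renyiSlope (α i) (Real.exp s))
      (∑ i, c i * ((if α i = 1 then 1 else α i - 1) * Real.exp ((α i - 1) * s))) s := fun s =>
    (HasDerivAt.fun_sum fun i _ => (hslope i s).const_mul (c i)).const_add a
  have hlog : Function.Injective fun j => Real.log (x j) := fun j k hjk =>
    hx (Real.log_injOn_pos (hx0 j) (hx0 k) hjk)
  obtain ⟨W, hW, hWcard⟩ := exists_finset_deriv_zeros hder
    (Finset.univ.image fun j => Real.log (x j)) (by
      intro z hz
      obtain ⟨j, -, rfl⟩ := Finset.mem_image.1 hz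
      simpa only [Real.exp_log (hx0 j)] using h j)
  rw [Finset.card_image_of_injective _ hlog, Finset.card_univ, Fintype.card_fin] at hWcard
  have hc : ∀ i, c i = 0 := by
    intro i
    have := exp_sum_coeff_eq_zero Finset.univ (fun i => α i - 1)
      (fun i _ k _ hik => hα (sub_left_injective hik))
      (fun i => c i * (if α i = 1 then 1 else α i - 1)) W
      (fun w hw => by simpa only [mul_assoc] using hW w hw)
      (by simpa using hWcard) i (Finset.mem_univ i)
    refine (mul_eq_zero.1 this).resolve_right ?_
    split_ifs with h1
    · exact one_ne_zero
    · exact sub_ne_zero.2 h1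
  refine ⟨?_, hc⟩
  simpa [hc] using h 0

theorem sum_extend {ι κ : Type*} [Fintype ι] [Fintype κ] {e : κ → ι} (he : Function.Injective e)
    (x : κ → ℝ) (p : ι → ℝ) (g : ℝ → ℝ) :
    ∑ i, g (Function.extend e x p i) = (∑ i, g (p i) - ∑ j, g (p (e j))) + ∑ j, g (x j) := by
  classical
  have split : ∀ u : ι → ℝ,
      ∑ i, u i = ∑ i ∈ (Finset.univ.image e)ᶜ, u i + ∑ j, u (e j) := by
    intro u
    rw [← Finset.sum_image (g := e) (f := u) (s := Finset.univ) he.injOn,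
      Finset.sum_compl_add_sum]
  rw [split, split fun i => g (p i)]
  simp only [he.extend_apply]
  rw [Finset.sum_congr rfl fun i hi => by
    rw [Function.extend_apply' _ _ _ (by simpa using hi)]]
  ring

theorem hasStrictFDerivAt_sum_extend {ι κ : Type*} [Fintype ι] [Fintype κ] {e : κ → ι}
    (he : Function.Injective e) (p : ι → ℝ) {g g' : ℝ → ℝ}
    (hg : ∀ j, HasStrictDerivAt g (g' (p (e j))) (p (e j))) :
    HasStrictFDerivAt (fun x : κ → ℝ => ∑ i, g (Function.extend e x p i))
      (∑ j, g' (p (e j)) • ContinuousLinearMap.proj (R := ℝ) (φ := fun _ : κ => ℝ) j)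
      (p ∘ e) := by
  simp only [sum_extend he]
  refine (HasStrictFDerivAt.fun_sum fun j _ => ?_).const_add _
  exact HasStrictDerivAt.comp_hasStrictFDerivAt (p ∘ e) (hg j)
    (hasStrictFDerivAt_apply (𝕜 := ℝ) j (p ∘ e))

theorem extend_comp_self {ι κ : Type*} {e : κ → ι} (he : Function.Injective e) (p : ι → ℝ) :
    Function.extend e (p ∘ e) p = p := by
  ext i
  by_cases h : ∃ j, e j = i
  · obtain ⟨j, rfl⟩ := h
    exact he.extend_apply _ _ j
  · exact Function.extend_apply' _ _ _ h

theorem exists_hasStrictFDerivAt_renyiH {n : ℕ} {κ : Type*} [Fintype κ] [Nonempty κ]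
    {e : κ → Fin n} (he : Function.Injective e) {p : Fin n → ℝ} (hp : ∀ i, 0 ≤ p i)
    (hpe : ∀ j, 0 < p (e j)) {α : ℝ} (hα : 0 < α) :
    ∃ K : ℝ, K ≠ 0 ∧ HasStrictFDerivAt (fun x => renyiH α (Function.extend e x p))
      (K • ∑ j, renyiSlope α (p (e j)) •
        ContinuousLinearMap.proj (R := ℝ) (φ := fun _ : κ => ℝ) j) (p ∘ e) := by
  by_cases h1 : α = 1
  · refine ⟨-1, by norm_num, ?_⟩
    simp only [renyiH, renyiSlope, h1, if_true]
    refine (hasStrictFDerivAt_sum_extend he p (g := fun t => t * Real.log t)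
      (g' := fun t => Real.log t + 1) fun j => ?_).fun_neg.congr_fderiv
      (neg_one_smul ℝ _).symm
    have h := (hasStrictDerivAt_id (p (e j))).fun_mul (Real.hasStrictDerivAt_log (hpe j).ne')
    simp only [id, one_mul, mul_inv_cancel₀ (hpe j).ne'] at h
    exact h
  · have hS : 0 < ∑ i, p i ^ α := by
      obtain ⟨j⟩ := ‹Nonempty κ›
      exact Finset.sum_pos' (fun i _ => Real.rpow_nonneg (hp i) α)
        ⟨e j, Finset.mem_univ _, Real.rpow_pos_of_pos (hpe j) α⟩
    refine ⟨1 / (1 - α) * ((∑ i, p i ^ α)⁻¹ * α), ?_, ?_⟩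
    · have : 1 - α ≠ 0 := sub_ne_zero.2 (Ne.symm h1)
      positivity
    · simp only [renyiH, renyiSlope, h1, if_false]
      have hd := hasStrictFDerivAt_sum_extend he p (g := fun t => t ^ α)
        (g' := fun t => α * t ^ (α - 1)) fun j =>
          Real.hasStrictDerivAt_rpow_const_of_ne (hpe j).ne' α
      have hl := (hd.log (by simpa only [extend_comp_self he] using hS.ne')).const_mul
        (1 / (1 - α))
      refine hl.congr_fderiv (ContinuousLinearMap.ext fun v => ?_)
      simp only [extend_comp_self he, smul_apply, sum_apply, smul_eq_mul, Finset.mul_sum]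
      exact Finset.sum_congr rfl fun j _ => by ring

theorem renyi_point_mem_interior
    (m n : ℕ) (hm : 1 ≤ m) (α : Fin m → ℝ)
    (hα0 : ∀ i, 0 < α i) (hαm : StrictMono α)
    (hn : m + 2 ≤ n) (p : Fin n → ℝ)
    (hp : ∀ i, 0 ≤ p i) (hps : ∑ i, p i = 1)
    (hdist : ∃ e : Fin (m + 1) → Fin n,
      (∀ j, 0 < p (e j)) ∧ Function.Injective fun j => p (e j)) :
    (fun i => renyiH (α i) p) ∈
      interior {y : Fin m → ℝ | ∃ q : Fin n → ℝ,
        (∀ i, 0 ≤ q i) ∧ ∑ i, q i = 1 ∧ y = fun i => renyiH (α i) q} := by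
  obtain ⟨e, hpe, hinj⟩ := hdist
  have he : Function.Injective e := fun j k h => hinj (congrArg p h)
  choose K hK hder using fun i => exists_hasStrictFDerivAt_renyiH he hp hpe (hα0 i)
  have hsum := hasStrictFDerivAt_sum_extend he p (g := fun t => t) (g' := fun _ => 1)
    fun j => hasStrictDerivAt_id _
  have hG := hsum.prodMk (hasStrictFDerivAt_pi.2 hder)
  have hsurj : LinearMap.range (ContinuousLinearMap.toLinearMap
      ((∑ j, (1 : ℝ) • ContinuousLinearMap.proj j).prod (ContinuousLinearMap.pi fun i =>
        K i • ∑ j, renyiSlope (α i) (p (e j)) •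
          ContinuousLinearMap.proj (R := ℝ) (φ := fun _ : Fin (m + 1) => ℝ) j))) = ⊤ := by
    by_contra hlt
    obtain ⟨φ, hφ, hle⟩ := Submodule.exists_le_ker_of_lt_top _ (lt_top_iff_ne_top.2 hlt)
    have hφ_eq : ∀ (a : ℝ) (y : Fin m → ℝ),
        φ (a, y) = a * φ (1, 0) + ∑ i, y i * φ (0, Pi.single i 1) := by
      intro a y
      have hy : (a, y) = a • ((1 : ℝ), (0 : Fin m → ℝ)) +
          ∑ i, y i • ((0 : ℝ), (Pi.single i 1 : Fin m → ℝ)) := by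
        ext k
        · simp [Prod.fst_sum]
        · simp [Prod.snd_sum, Finset.sum_apply, Pi.single_apply]
      rw [hy, map_add, map_sum]
      simp only [map_smul, smul_eq_mul]
    have hvan : ∀ j, φ (1, 0) + ∑ i, (K i * φ (0, Pi.single i 1)) *
        renyiSlope (α i) (p (e j)) = 0 := by
      intro j
      have h := LinearMap.mem_ker.1 (hle ⟨Pi.single j 1, rfl⟩)
      simp only [ContinuousLinearMap.coe_coe, ContinuousLinearMap.prod_apply] at h
      rw [hφ_eq] at h
      simp [Pi.single_apply] at h
      simpa only [mul_right_comm] using h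
    obtain ⟨h0, hc⟩ := renyiSlope_independent hαm.injective hpe hinj _ _ hvan
    refine hφ (LinearMap.ext fun ⟨a, y⟩ => ?_)
    rw [hφ_eq, h0, Finset.sum_eq_zero fun i _ => by
      rw [(mul_eq_zero.1 (hc i)).resolve_left (hK i), mul_zero]]
    simp
  have hmap := hG.map_nhds_eq_of_surj hsurj
  simp only [extend_comp_self he, hps] at hmap
  have hpos : ∀ᶠ x in nhds (p ∘ e), ∀ j, 0 < x j :=
    eventually_all.2 fun j => (continuous_apply j).continuousAt.eventually (lt_mem_nhds (hpe j))
  have himg := image_mem_map (m := fun x : Fin (m + 1) → ℝ =>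
    (∑ i, Function.extend e x p i, fun i => renyiH (α i) (Function.extend e x p))) hpos
  rw [hmap] at himg
  have hcont : Continuous fun y : Fin m → ℝ => ((1 : ℝ), y) := by fun_prop
  refine mem_interior_iff_mem_nhds.2 (mem_of_superset (hcont.continuousAt himg) ?_)
  rintro y ⟨x, hx, hxy⟩
  obtain ⟨h1, h2⟩ := Prod.mk.inj hxy
  refine ⟨Function.extend e x p, fun i => ?_, h1, h2.symm⟩
  by_cases h : ∃ j, e j = i
  · obtain ⟨j, rfl⟩ := h
    rw [he.extend_apply]
    exact (hx j).le
  · rw [Function.extend_apply' _ _ _ h]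
    exact hp i
end

section
/- Let P be a probability vector on n points and let k be a positive integer with k + 1 ≤ n and log k ≤ H_1(P) < log(k+1). Then there exists s ∈ [0,1] such that the mixture Q = s·U_k + (1−s)·U_{k+1} satisfies H_1(Q) = H_1(P) and H_2(P) ≤ H_2(Q). That is, the upper bound on H_2(P) given H_1(P) is attained by a mixture of uniform distributions on k and k+1 points. -/
open Real Filter

/-- Quadratic lower bound for `u * log u` around `v`; for `c = 0` this is the tangent line bound. -/
lemma mul_log_ge_tangent_add_sq {u v c : ℝ} (hu : 0 ≤ u) (hv : 0 < v)
    (hcu : c * u ≤ 1) (hcv : c * v ≤ 1) :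
    v * log v + (u - v) * (1 + log v) + c / 2 * (u - v) ^ 2 ≤ u * log u := by
  rcases hu.eq_or_lt with rfl | hu
  · nlinarith
  have hlog : log u = log v + log (u / v) := by
    rw [Real.log_div hu.ne' hv.ne']; ring
  suffices h : (u - v) + c / 2 * (u - v) ^ 2 ≤ u * log (u / v) by rw [hlog]; linarith
  rcases le_total v u with huv | huv
  · have h1 := Real.le_log_one_add_of_nonneg (x := (u - v) / v) (by
      apply div_nonneg <;> linarith)
    have e1 : 1 + (u - v) / v = u / v := by field_simp; ring
    have e2 : 2 * ((u - v) / v) / ((u - v) / v + 2) = 2 * (u - v) / (u + v) := by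
      have : (u - v) / v + 2 = (u + v) / v := by field_simp; ring
      rw [this]; field_simp
    rw [e1, e2] at h1
    have h2 : c ≤ 1 / u := by rw [le_div_iff₀ hu]; exact hcu
    calc (u - v) + c / 2 * (u - v) ^ 2 ≤ (u - v) + 1 / u / 2 * (u - v) ^ 2 := by gcongr
      _ ≤ u * (2 * (u - v) / (u + v)) := by
        rw [← sub_nonneg]
        have : u * (2 * (u - v) / (u + v)) - ((u - v) + 1 / u / 2 * (u - v) ^ 2)
            = (u - v) ^ 3 / (2 * u * (u + v)) := by field_simp; ring
        rw [this]
        have : 0 ≤ u - v := by linarith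
        positivity
      _ ≤ u * log (u / v) := by gcongr
  · have h1 : log (v / u) ≤ (v / u - u / v) / 2 := by
      have h := Real.sinh_log (x := v / u) (by positivity)
      have h' := Real.self_le_sinh_iff.2 (Real.log_nonneg ((one_le_div hu).2 huv))
      rw [h, inv_div] at h'
      exact h'
    have h0 : log (u / v) = -log (v / u) := by rw [← Real.log_inv, inv_div]
    have h2 : c ≤ 1 / v := by rw [le_div_iff₀ hv]; exact hcv
    calc (u - v) + c / 2 * (u - v) ^ 2 ≤ (u - v) + 1 / v / 2 * (u - v) ^ 2 := by gcongr
      _ = u * -((v / u - u / v) / 2) := by field_simp; ring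
      _ ≤ u * log (u / v) := by rw [h0]; gcongr

lemma mul_log_ge_tangent {u v : ℝ} (hu : 0 ≤ u) (hv : 0 < v) :
    v * log v + (u - v) * (1 + log v) ≤ u * log u := by
  have := mul_log_ge_tangent_add_sq (c := 0) hu hv (by simp) (by simp)
  simpa using this

lemma log_sub_log_lt {x y : ℝ} (hx : 0 < x) (hy : 0 < y) (hne : x ≠ y) :
    log x - log y < (x - y) / y := by
  have := Real.log_lt_sub_one_of_pos (div_pos hx hy) (by rwa [Ne, div_eq_one_iff_eq hy.ne'])
  rw [Real.log_div hx.ne' hy.ne'] at this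
  rwa [sub_div, div_self hy.ne']

lemma eventually_pos_right {f : ℝ → ℝ} (hf : Continuous f) (h0 : 0 < f 0) :
    ∀ᶠ t in nhdsWithin (0 : ℝ) (Set.Ioi 0), 0 < f t :=
  (hf.continuousAt.eventually_const_lt h0).filter_mono nhdsWithin_le_nhds

/-- Three positive numbers with distinct values can be moved, keeping the sum, so that the
entropy does not increase and the sum of squares decreases. -/
lemma exists_move_of_lt_of_lt {x y z : ℝ} (hz : 0 < z) (hzy : z < y) (hyx : y < x) :
    ∃ x' y' z' : ℝ, 0 ≤ x' ∧ 0 ≤ y' ∧ 0 ≤ z' ∧ x' + y' + z' = x + y + z ∧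
      negMulLog x' + negMulLog y' + negMulLog z' ≤ negMulLog x + negMulLog y + negMulLog z ∧
      x' ^ 2 + y' ^ 2 + z' ^ 2 < x ^ 2 + y ^ 2 + z ^ 2 := by
  have hy : 0 < y := hz.trans hzy
  have hx : 0 < x := hy.trans hyx
  have hS : 0 < (y - z) * (log y - log x) + (x - y) * (log y - log z) := by
    have h1 := log_sub_log_lt hx hy hyx.ne'
    have h2 := log_sub_log_lt hz hy hzy.ne
    have h3 : 0 < (y - z) * ((x - y) / y - (log x - log y)) :=
      mul_pos (by linarith) (by linarith)
    have h4 : 0 < (x - y) * ((z - y) / y - (log z - log y)) :=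
      mul_pos (by linarith) (by linarith)
    have h5 : (y - z) * ((x - y) / y) + (x - y) * ((z - y) / y) = 0 := by ring
    linarith
  have hL : 0 < log x - log z := sub_pos.2 (Real.log_lt_log hz (hzy.trans hyx))
  obtain ⟨S, hS_def⟩ : ∃ S, S = (y - z) * (log y - log x) + (x - y) * (log y - log z) := ⟨_, rfl⟩
  rw [← hS_def] at hS
  obtain ⟨ε, hε⟩ : ∃ ε, ε = S / (log x - log z) := ⟨_, rfl⟩
  have hε0 : 0 < ε := by rw [hε]; positivity
  have hεL : ε * (log x - log z) = S := by rw [hε]; field_simp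
  have e1 := eventually_pos_right (f := fun t => x + t * (z - y - ε)) (by fun_prop) (by simpa)
  have e2 := eventually_pos_right (f := fun t => z + t * (y - x + ε)) (by fun_prop) (by simpa)
  have e3 := eventually_pos_right (f := fun t => 2 * ε * (x - z)
    - t * ((z - y - ε) ^ 2 + (x - z) ^ 2 + (y - x + ε) ^ 2)) (by fun_prop) (by
      have : 0 < x - z := by linarith
      simp only [zero_mul, sub_zero]; positivity)
  obtain ⟨t, ⟨⟨h1, h2⟩, h3⟩, ht⟩ := (((e1.and e2).and e3).and self_mem_nhdsWithin).exists
  have ht : 0 < t := ht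
  have hy' : 0 < y + t * (x - z) := by
    have : 0 < x - z := by linarith
    positivity
  refine ⟨x + t * (z - y - ε), y + t * (x - z), z + t * (y - x + ε), h1.le, hy'.le, h2.le,
    by ring, ?_, ?_⟩
  · simp only [negMulLog]
    have a1 := mul_log_ge_tangent h1.le hx
    have a2 := mul_log_ge_tangent hy'.le hy
    have a3 := mul_log_ge_tangent h2.le hz
    have : t * (z - y - ε) * log x + t * (x - z) * log y + t * (y - x + ε) * log z = 0 := by
      have : t * (z - y - ε) * log x + t * (x - z) * log y + t * (y - x + ε) * log z
        = t * (S - ε * (log x - log z)) := by rw [hS_def]; ring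
      rw [this, hεL]; ring
    linarith
  · nlinarith [mul_pos ht h3]

/-- A move as in `exists_move_of_lt_of_lt` when the two smaller numbers agree. -/
lemma exists_move_of_lt_of_eq {x y : ℝ} (hy : 0 < y) (hyx : y < x) :
    ∃ x' y' z' : ℝ, 0 ≤ x' ∧ 0 ≤ y' ∧ 0 ≤ z' ∧ x' + y' + z' = x + y + y ∧
      negMulLog x' + negMulLog y' + negMulLog z' ≤ negMulLog x + negMulLog y + negMulLog y ∧
      x' ^ 2 + y' ^ 2 + z' ^ 2 < x ^ 2 + y ^ 2 + y ^ 2 := by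
  have hx : 0 < x := hy.trans hyx
  have hL : 0 < log x - log y := sub_pos.2 (Real.log_lt_log hy hyx)
  have hd : 0 < x - y := sub_pos.2 hyx
  obtain ⟨a, ha1, ha2⟩ : ∃ a, 1 / (x - y) < a ∧ a < 1 / y / (log x - log y) := by
    apply exists_between
    rw [lt_div_iff₀ hL]
    have := log_sub_log_lt hx hy hyx.ne'
    calc 1 / (x - y) * (log x - log y) < 1 / (x - y) * ((x - y) / y) := by gcongr
      _ = 1 / y := by field_simp
  have ha : 0 < a := lt_trans (by positivity) ha1
  rw [div_lt_iff₀ hd] at ha1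
  rw [lt_div_iff₀ hL] at ha2
  obtain ⟨c, hc1, hc2⟩ := exists_between ha2
  have hc : 0 < c := lt_trans (by positivity) hc1
  rw [lt_div_iff₀ hy] at hc2
  have e1 := eventually_pos_right (f := fun t => x - a * t ^ 2) (by fun_prop) (by simpa)
  have e2 := eventually_pos_right (f := fun t => y - t + a / 2 * t ^ 2) (by fun_prop) (by simpa)
  have e3 := eventually_pos_right (f := fun t => 1 - c * (y + t + a / 2 * t ^ 2)) (by fun_prop) (by simpa)
  have e4 := eventually_pos_right (f := fun t => 2 * (a * (x - y) - 1) - 3 / 2 * a ^ 2 * t ^ 2) (by fun_prop)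
    (by simpa)
  obtain ⟨t, ⟨⟨⟨h1, h2⟩, h3⟩, h4⟩, ht⟩ :=
    ((((e1.and e2).and e3).and e4).and self_mem_nhdsWithin).exists
  have ht : 0 < t := ht
  have hy' : 0 < y + t + a / 2 * t ^ 2 := by positivity
  refine ⟨x - a * t ^ 2, y + t + a / 2 * t ^ 2, y - t + a / 2 * t ^ 2, h1.le, hy'.le, h2.le,
    by ring, ?_, ?_⟩
  · simp only [negMulLog]
    have a1 := mul_log_ge_tangent h1.le hx
    have a2 := mul_log_ge_tangent_add_sq hy'.le hy (by linarith) hc2.le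
    have a3 := mul_log_ge_tangent_add_sq h2.le hy (by nlinarith) hc2.le
    have a4 : 0 ≤ t ^ 2 * (c - a * (log x - log y)) := by
      have : 0 < c - a * (log x - log y) := by linarith
      positivity
    have a5 : 0 ≤ c / 4 * a ^ 2 * t ^ 4 := by positivity
    have a6 : c / 2 * (y + t + a / 2 * t ^ 2 - y) ^ 2 + c / 2 * (y - t + a / 2 * t ^ 2 - y) ^ 2
      = c * t ^ 2 + c / 4 * a ^ 2 * t ^ 4 := by ring
    linarith
  · nlinarith [mul_pos (pow_pos ht 2) h4]

lemma exists_move {x y z : ℝ} (hz : 0 < z) (hzy : z ≤ y) (hyx : y < x) :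
    ∃ x' y' z' : ℝ, 0 ≤ x' ∧ 0 ≤ y' ∧ 0 ≤ z' ∧ x' + y' + z' = x + y + z ∧
      negMulLog x' + negMulLog y' + negMulLog z' ≤ negMulLog x + negMulLog y + negMulLog z ∧
      x' ^ 2 + y' ^ 2 + z' ^ 2 < x ^ 2 + y ^ 2 + z ^ 2 := by
  rcases hzy.eq_or_lt with rfl | hzy
  · exact exists_move_of_lt_of_eq hz hyx
  · exact exists_move_of_lt_of_lt hz hzy hyx

lemma sum_comp_update {ι : Type*} [Fintype ι] [DecidableEq ι] (g : ℝ → ℝ) (r : ι → ℝ) (i : ι)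
    (x : ℝ) : ∑ m, g (Function.update r i x m) = ∑ m, g (r m) + (g x - g (r i)) := by
  rw [← Finset.add_sum_erase _ _ (Finset.mem_univ i),
    ← Finset.add_sum_erase Finset.univ (fun m => g (r m)) (Finset.mem_univ i),
    Finset.sum_congr rfl (g := fun m => g (r m)) fun m hm => by
      rw [Function.update_of_ne (Finset.ne_of_mem_erase hm)]]
  simp only [Function.update_self]
  ring

/-- `r` minimizes the sum of squares among probability vectors of entropy at most `h`. -/
def IsMinSq {ι : Type*} [Fintype ι] (h : ℝ) (r : ι → ℝ) : Prop :=
  (∀ i, 0 ≤ r i) ∧ ∑ i, r i = 1 ∧ ∑ i, negMulLog (r i) ≤ h ∧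
    ∀ q : ι → ℝ, (∀ i, 0 ≤ q i) → ∑ i, q i = 1 → ∑ i, negMulLog (q i) ≤ h →
      ∑ i, r i ^ 2 ≤ ∑ i, q i ^ 2

lemma exists_isMinSq {ι : Type*} [Fintype ι] {h : ℝ} {p : ι → ℝ} (hp : ∀ i, 0 ≤ p i)
    (hps : ∑ i, p i = 1) (hh : ∑ i, negMulLog (p i) ≤ h) : ∃ r : ι → ℝ, IsMinSq h r := by
  have hcl : IsClosed {q : ι → ℝ | ∑ i, negMulLog (q i) ≤ h} :=
    isClosed_le (continuous_finsetSum _ fun i _ =>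
      continuous_negMulLog.comp (continuous_apply i)) continuous_const
  obtain ⟨r, hr, hmin⟩ := ((isCompact_stdSimplex ℝ ι).inter_right hcl).exists_isMinOn
    ⟨p, ⟨hp, hps⟩, hh⟩
    (f := fun q : ι → ℝ => ∑ i, q i ^ 2) (by fun_prop)
  exact ⟨r, hr.1.1, hr.1.2, hr.2, fun q h0 h1 h2 => hmin ⟨⟨h0, h1⟩, h2⟩⟩

lemma IsMinSq.not_three {ι : Type*} [Fintype ι] {h : ℝ} {r : ι → ℝ} (hr : IsMinSq h r)
    {i j l : ι} (hjl : j ≠ l) (hl : 0 < r l) (hlj : r l ≤ r j) (hji : r j < r i) : False := by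
  classical
  obtain ⟨h0, h1, h2, hmin⟩ := hr
  have hij : i ≠ j := fun e => by simp [e] at hji
  have hil : i ≠ l := fun e => by subst e; linarith
  obtain ⟨x', y', z', hx, hy, hz, hs, hH, hq⟩ := exists_move hl hlj hji
  have key : ∀ g : ℝ → ℝ,
      ∑ m, g (Function.update (Function.update (Function.update r i x') j y') l z' m)
        = ∑ m, g (r m) + (g x' + g y' + g z' - (g (r i) + g (r j) + g (r l))) := fun g => by
    rw [sum_comp_update, sum_comp_update, sum_comp_update, Function.update_of_ne hjl.symm,
      Function.update_of_ne hil.symm, Function.update_of_ne hij.symm]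
    ring
  have := hmin _ (fun m => ?_) ((key fun u => u).trans ?_) ((key _).trans_le ?_)
  · rw [key (· ^ 2)] at this
    linarith
  · simp only [Function.update_apply]
    split_ifs <;> first | assumption | exact h0 m
  · linarith
  · linarith

lemma IsMinSq.entropy_eq {ι : Type*} [Fintype ι] {h : ℝ} {r : ι → ℝ} (hr : IsMinSq h r)
    (hh : h < log (Fintype.card ι)) : ∑ i, negMulLog (r i) = h := by
  classical
  obtain ⟨h0, h1, h2, hmin⟩ := hr
  by_contra hne
  have hlt : ∑ i, negMulLog (r i) < h := lt_of_le_of_ne h2 hne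
  obtain ⟨i, j, hij⟩ : ∃ i j, r j < r i := by
    by_contra! hc
    have hcard : ∀ i, r i = (Fintype.card ι : ℝ)⁻¹ := fun i => by
      have : ∑ j, r j = ∑ _j : ι, r i := Finset.sum_congr rfl fun j _ => le_antisymm (hc _ _) (hc _ _)
      rw [h1] at this
      simp only [Finset.sum_const, Finset.card_univ, nsmul_eq_mul] at this
      exact eq_inv_of_mul_eq_one_right this.symm
    have : ∑ i, negMulLog (r i) = log (Fintype.card ι) := by
      have e : ∀ i, negMulLog (r i) = r i * log (Fintype.card ι) := fun i => by
        rw [negMulLog, hcard i, Real.log_inv]; ring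
      simp_rw [e, ← Finset.sum_mul, h1, one_mul]
    linarith
  have hne : j ≠ i := fun e => by simp [e] at hij
  have key : ∀ (g : ℝ → ℝ) (t : ℝ),
      ∑ m, g (Function.update (Function.update r i (r i - t)) j (r j + t) m)
        = ∑ m, g (r m) + (g (r i - t) + g (r j + t) - (g (r i) + g (r j))) := fun g t => by
    rw [sum_comp_update, sum_comp_update, Function.update_of_ne hne]
    ring
  have hcont : Continuous fun t : ℝ => ∑ m, negMulLog (r m) + (negMulLog (r i - t)
      + negMulLog (r j + t) - (negMulLog (r i) + negMulLog (r j))) := by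
    have := continuous_negMulLog
    fun_prop
  have e1 : ∀ᶠ t in nhdsWithin (0 : ℝ) (Set.Ioi 0), ∑ m, negMulLog (r m) + (negMulLog (r i - t)
      + negMulLog (r j + t) - (negMulLog (r i) + negMulLog (r j))) < h :=
    (hcont.continuousAt.eventually_lt_const (by simpa using hlt)).filter_mono nhdsWithin_le_nhds
  have e2 : ∀ᶠ t in nhdsWithin (0 : ℝ) (Set.Ioi 0), t < r i - r j :=
    (gt_mem_nhds (sub_pos.2 hij)).filter_mono nhdsWithin_le_nhds
  obtain ⟨t, ⟨ht1, ht2⟩, ht⟩ := ((e1.and e2).and self_mem_nhdsWithin).exists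
  have ht : 0 < t := ht
  have hj := h0 j
  have := hmin _ (fun m => ?_) ((key (fun u => u) t).trans ?_) ((key _ t).trans_le ht1.le)
  · rw [key (· ^ 2)] at this
    nlinarith [mul_pos ht (sub_pos.2 ht2)]
  · simp only [Function.update_apply]
    split_ifs <;> first | exact h0 m | linarith
  · linarith

/-- A minimizer has `m` equal largest entries and at most one further nonzero entry. -/
lemma IsMinSq.exists_form {ι : Type*} [Fintype ι] {h : ℝ} {r : ι → ℝ} (hr : IsMinSq h r) :
    ∃ (m : ℕ) (a b : ℝ), 1 ≤ m ∧ 0 ≤ b ∧ b < a ∧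
      ∀ g : ℝ → ℝ, g 0 = 0 → ∑ i, g (r i) = m * g a + g b := by
  classical
  obtain ⟨h0, h1, -, -⟩ := id hr
  have hne : Nonempty ι := by
    by_contra hc
    rw [not_nonempty_iff] at hc
    simp at h1
  obtain ⟨i, hi⟩ := Finite.exists_max r
  have hpos : 0 < r i := by
    by_contra! hc
    have : ∑ j, r j ≤ 0 := Finset.sum_nonpos fun j _ => (hi j).trans hc
    linarith
  have hsplit : ∀ g : ℝ → ℝ, ∑ j, g (r j) = (Finset.univ.filter fun j => r j = r i).card * g (r i)
      + ∑ j ∈ Finset.univ.filter (fun j => ¬ r j = r i), g (r j) := fun g => by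
    rw [← Finset.sum_filter_add_sum_filter_not Finset.univ (fun j => r j = r i),
      Finset.sum_congr rfl (g := fun _ => g (r i)) fun j hj => by
        rw [(Finset.mem_filter.1 hj).2]]
    simp
  have hm : 1 ≤ (Finset.univ.filter fun j => r j = r i).card :=
    Finset.card_pos.2 ⟨i, by simp⟩
  by_cases hb : ∃ j, r j ≠ r i ∧ 0 < r j
  · obtain ⟨j, hj, hj0⟩ := hb
    have hji := lt_of_le_of_ne (hi j) hj
    refine ⟨_, r i, r j, hm, hj0.le, hji, fun g hg => ?_⟩
    rw [hsplit, Finset.sum_eq_single j]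
    · intro l hl hlj
      have hl : r l ≠ r i := (Finset.mem_filter.1 hl).2
      rcases (h0 l).eq_or_lt with e | hl0
      · rw [← e, hg]
      · rcases le_total (r l) (r j) with hle | hle
        · exact (hr.not_three hlj.symm hl0 hle hji).elim
        · exact (hr.not_three hlj hj0 hle (lt_of_le_of_ne (hi l) hl)).elim
    · simp [hj]
  · push Not at hb
    refine ⟨_, r i, 0, hm, le_rfl, hpos, fun g hg => ?_⟩
    rw [hsplit, hg, Finset.sum_eq_zero]
    intro l hl
    rw [le_antisymm (hb l (Finset.mem_filter.1 hl).2) (h0 l), hg]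

lemma log_le_entropy {m : ℕ} {a b : ℝ} (hm : 1 ≤ m) (hb : 0 ≤ b) (hba : b < a)
    (hs : m * a + b = 1) : log m ≤ m * negMulLog a + negMulLog b := by
  have hm0 : (0 : ℝ) < m := by exact_mod_cast hm
  have ha : 0 < a := hb.trans_lt hba
  have key : ∀ u, 0 ≤ u → u ≤ a → u * log m ≤ negMulLog u := fun u hu hua => by
    rcases hu.eq_or_lt with rfl | hu
    · simp
    have : log (m * u) ≤ 0 := Real.log_nonpos (by positivity) (by nlinarith)
    rw [Real.log_mul hm0.ne' hu.ne'] at this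
    rw [negMulLog]
    nlinarith
  have h1 := key a ha.le le_rfl
  have h2 := key b hb hba.le
  calc log m = m * (a * log m) + b * log m := by linear_combination (-log m) * hs
    _ ≤ _ := by gcongr

lemma entropy_lt_log {m : ℕ} {a b : ℝ} (hm : 1 ≤ m) (hb : 0 ≤ b) (hba : b < a)
    (hs : m * a + b = 1) : m * negMulLog a + negMulLog b < log (m + 1) := by
  have hm0 : (0 : ℝ) < m + 1 := by positivity
  have ha : 0 < a := hb.trans_lt hba
  have hlog : negMulLog a < a * log (m + 1) + (m + 1 : ℝ)⁻¹ - a := by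
    have h := log_sub_log_lt (inv_pos.2 hm0) ha (by
      rw [Ne, inv_eq_iff_eq_inv, ← one_div, eq_div_iff ha.ne']
      linarith)
    rw [Real.log_inv, lt_div_iff₀ ha] at h
    rw [negMulLog]
    linarith
  have hlog' : negMulLog b ≤ b * log (m + 1) + (m + 1 : ℝ)⁻¹ - b := by
    have := mul_log_ge_tangent hb (inv_pos.2 hm0)
    rw [Real.log_inv] at this
    rw [negMulLog]
    linarith
  have hm1 : (0 : ℝ) < m := by
    exact_mod_cast hm
  have hinv : (m + 1) * (m + 1 : ℝ)⁻¹ = 1 := mul_inv_cancel₀ hm0.ne'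
  calc m * negMulLog a + negMulLog b
      < m * (a * log (m + 1) + (m + 1 : ℝ)⁻¹ - a) + (b * log (m + 1) + (m + 1 : ℝ)⁻¹ - b) := by
        exact add_lt_add_of_lt_of_le (mul_lt_mul_of_pos_left hlog hm1) hlog'
    _ = log (m + 1) := by linear_combination (log (m + 1) - 1) * hs + hinv

lemma sum_comp_mix (g : ℝ → ℝ) (hg : g 0 = 0) {n k : ℕ} (hkn : k + 1 ≤ n) (s : ℝ) :
    ∑ i, g (s * unif n k i + (1 - s) * unif n (k + 1) i)
      = k * g (s * (k : ℝ)⁻¹ + (1 - s) * (k + 1 : ℝ)⁻¹) + g ((1 - s) * (k + 1 : ℝ)⁻¹) := by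
  obtain ⟨d, rfl⟩ := Nat.exists_eq_add_of_le hkn
  simp only [unif]
  have h1 : ∀ i ∈ Finset.range k, g (s * (if i < k then (k : ℝ)⁻¹ else 0)
      + (1 - s) * (if i < k + 1 then ((k + 1 : ℕ) : ℝ)⁻¹ else 0))
      = g (s * (k : ℝ)⁻¹ + (1 - s) * (k + 1 : ℝ)⁻¹) := fun i hi => by
    have := Finset.mem_range.1 hi
    simp [this, show i < k + 1 by omega]
  have h2 : ∀ i ∈ Finset.range d, g (s * (if k + 1 + i < k then (k : ℝ)⁻¹ else 0)
      + (1 - s) * (if k + 1 + i < k + 1 then ((k + 1 : ℕ) : ℝ)⁻¹ else 0)) = 0 := fun i _ => by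
    rw [if_neg (by omega), if_neg (by omega), mul_zero, mul_zero, add_zero, hg]
  rw [Fin.sum_univ_eq_sum_range (fun i => g (s * (if i < k then (k : ℝ)⁻¹ else 0)
    + (1 - s) * (if i < k + 1 then ((k + 1 : ℕ) : ℝ)⁻¹ else 0))), Finset.sum_range_add,
    Finset.sum_range_succ, Finset.sum_congr rfl h1, Finset.sum_eq_zero h2]
  simp

lemma renyiH_one {n : ℕ} (p : Fin n → ℝ) : renyiH 1 p = ∑ i, negMulLog (p i) := by
  simp [renyiH, negMulLog]

lemma renyiH_two {n : ℕ} (p : Fin n → ℝ) : renyiH 2 p = -log (∑ i, p i ^ 2) := by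
  norm_num [renyiH]

theorem H2_upper_bound_given_H1
    (n k : ℕ) (hk : 1 ≤ k) (hkn : k + 1 ≤ n)
    (p : Fin n → ℝ) (hp : ∀ i, 0 ≤ p i) (hps : ∑ i, p i = 1)
    (hlow : Real.log k ≤ renyiH 1 p) (hhigh : renyiH 1 p < Real.log (k + 1)) :
    ∃ s ∈ Set.Icc (0 : ℝ) 1,
      renyiH 1 (fun i => s * unif n k i + (1 - s) * unif n (k + 1) i) = renyiH 1 p ∧
      renyiH 2 p ≤ renyiH 2 (fun i => s * unif n k i + (1 - s) * unif n (k + 1) i) := by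
  simp only [renyiH_one, renyiH_two] at *
  obtain ⟨r, hr⟩ := exists_isMinSq hp hps le_rfl
  have hk0 : (0 : ℝ) < k := by exact_mod_cast hk
  have hH := hr.entropy_eq (hhigh.trans_le (Real.log_le_log (by positivity) (by
    rw [Fintype.card_fin]; exact_mod_cast hkn)))
  obtain ⟨m, a, b, hm, hb, hba, hform⟩ := hr.exists_form
  have hs : m * a + b = 1 := (hform id rfl).symm.trans hr.2.1
  rw [hform _ negMulLog_zero] at hH
  have hm0 : (0 : ℝ) < m := by exact_mod_cast hm
  obtain rfl : m = k := by
    have h1 := (log_le_entropy hm hb hba hs).trans_lt (hH.trans_lt hhigh)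
    have h2 := hlow.trans_lt (hH.symm.trans_lt (entropy_lt_log hm hb hba hs))
    rw [Real.log_lt_log_iff (by positivity) (by positivity)] at h1 h2
    norm_cast at h1 h2
    omega
  have hb' : (1 - (1 - (m + 1) * b)) * (m + 1 : ℝ)⁻¹ = b := by field_simp; ring
  have ha' : (1 - (m + 1) * b) * (m : ℝ)⁻¹ + b = a := by
    field_simp; linarith
  refine ⟨1 - (m + 1) * b, ⟨by nlinarith, ?_⟩, ?_, ?_⟩
  · have : 0 ≤ (m + 1) * b := by positivity
    linarith
  · rw [sum_comp_mix _ negMulLog_zero hkn, hb', ha', hH]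
  · rw [sum_comp_mix (· ^ 2) (by simp) hkn, hb', ha', ← hform (· ^ 2) (by simp)]
    have hpos : 0 < ∑ i, r i ^ 2 := by
      have := hform (· ^ 2) (by simp)
      rw [this]
      have : 0 < a := hb.trans_lt hba
      positivity
    exact neg_le_neg (Real.log_le_log hpos (hr.2.2.2 p hp hps le_rfl))
end

section
/- Let P be a probability vector on n points, n ≥ 2. Then there exists s ∈ [0,1] such that the mixture Q = s·U_n + (1−s)·U_1 satisfies H_1(Q) = H_1(P) and H_2(P) ≥ H_2(Q). That is, among probability vectors on n points the lower bound on H_2 given H_1 is attained by a mixture of the uniform distribution on n points and a point mass. -/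
open Real Filter

/-- The Bregman divergence of `x log x` at `1` is at most half the square above `1`. -/
lemma mul_log_sub_add_one_le {v : ℝ} (hv : 1 ≤ v) :
    v * log v - v + 1 ≤ (v - 1) ^ 2 / 2 := by
  have h0 : 0 < v := by linarith
  have h1 := Real.self_le_sinh_iff.2 (Real.log_nonneg hv)
  rw [Real.sinh_log h0] at h1
  have h2 := mul_le_mul_of_nonneg_left h1 h0.le
  have h3 : v * ((v - v⁻¹) / 2) = (v ^ 2 - 1) / 2 := by field_simp
  nlinarith

/-- The Bregman divergence of `x log x` at `1` is at least half the square below `1`. -/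
lemma le_mul_log_sub_add_one {u : ℝ} (hu : 0 ≤ u) (hu1 : u ≤ 1) :
    (u - 1) ^ 2 / 2 ≤ u * log u - u + 1 := by
  rcases hu.eq_or_lt with rfl | h0
  · norm_num
  have h1 := Real.sinh_le_self_iff.2 (Real.log_nonpos hu hu1)
  rw [Real.sinh_log h0] at h1
  have h2 := mul_le_mul_of_nonneg_left h1 h0.le
  have h3 : u * ((u - u⁻¹) / 2) = (u ^ 2 - 1) / 2 := by field_simp
  nlinarith

lemma antitoneOn_mul_log_sub_add_one_div_sq :
    AntitoneOn (fun u : ℝ => (u * log u - u + 1) / (u - 1) ^ 2) (Set.Ioi 1) := by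
  have hd : ∀ u ∈ Set.Ioi (1 : ℝ), HasDerivAt (fun u : ℝ => (u * log u - u + 1) / (u - 1) ^ 2)
      (((log u) * (u - 1) ^ 2 - (u * log u - u + 1) * (2 * (u - 1))) / ((u - 1) ^ 2) ^ 2) u := by
    intro u hu
    have hu : 1 < u := hu
    have h1 : HasDerivAt (fun u : ℝ => u * log u - u + 1) (log u) u := by
      exact (((Real.hasDerivAt_mul_log (x := u) (by linarith)).sub
        (hasDerivAt_id u)).add_const 1).congr_deriv (by ring)
    have h2 : HasDerivAt (fun u : ℝ => (u - 1) ^ 2) (2 * (u - 1)) u := by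
      exact (((hasDerivAt_id u).sub_const 1).pow 2).congr_deriv (by simp)
    exact h1.div h2 (pow_ne_zero _ (by linarith))
  refine antitoneOn_of_deriv_nonpos (convex_Ioi 1)
    (fun u hu => (hd u hu).continuousAt.continuousWithinAt) ?_ ?_
  · rw [interior_Ioi]
    exact fun u hu => (hd u hu).differentiableAt.differentiableWithinAt
  · rw [interior_Ioi]
    intro u hu
    rw [(hd u hu).deriv]
    have hu : 1 < u := hu
    refine div_nonpos_of_nonpos_of_nonneg ?_ (by positivity)
    have h := Real.le_log_one_add_of_nonneg (x := u - 1) (by linarith)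
    rw [div_le_iff₀ (by linarith), add_sub_cancel] at h
    have h2 : log u * (u - 1) ^ 2 - (u * log u - u + 1) * (2 * (u - 1))
        = (u - 1) * (2 * (u - 1) - log u * (u - 1 + 2)) := by ring
    rw [h2]
    exact mul_nonpos_of_nonneg_of_nonpos (by linarith) (by linarith)

lemma sq_mul_le_sq_mul_of_le {u v : ℝ} (hu : 0 ≤ u) (huv : u ≤ v) (hv : 1 < v) :
    (u - 1) ^ 2 * (v * log v - v + 1) ≤ (v - 1) ^ 2 * (u * log u - u + 1) := by
  rcases le_or_gt u 1 with h | h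
  · have h1 := mul_le_mul_of_nonneg_left (mul_log_sub_add_one_le hv.le) (sq_nonneg (u - 1))
    have h2 := mul_le_mul_of_nonneg_left (le_mul_log_sub_add_one hu h) (sq_nonneg (v - 1))
    linarith
  · have := antitoneOn_mul_log_sub_add_one_div_sq h hv huv
    simp only at this
    rw [div_le_div_iff₀ (pow_pos (by linarith) 2) (pow_pos (by linarith) 2)] at this
    linarith

lemma sub_sq_mul_le_sub_sq_mul {a b t : ℝ} (hb : 0 < b) (hba : b < a) (ht : 0 ≤ t) (hta : t ≤ a) :
    (t - b) ^ 2 * (a * log a - a * log b - a + b)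
      ≤ (a - b) ^ 2 * (t * log t - t * log b - t + b) := by
  have scale : ∀ x, 0 ≤ x → b * (x / b * log (x / b) - x / b + 1)
      = x * log x - x * log b - x + b := by
    intro x hx
    rcases hx.eq_or_lt with rfl | hx
    · simp
    · rw [Real.log_div hx.ne' hb.ne']
      field_simp
  have h := sq_mul_le_sq_mul_of_le (div_nonneg ht hb.le)
    (div_le_div_of_nonneg_right hta hb.le) ((one_lt_div hb).2 hba)
  have sq : ∀ x, (x - b) ^ 2 = b ^ 2 * (x / b - 1) ^ 2 := by
    intro x
    field_simp
  rw [← scale t ht, ← scale a (by linarith), sq t, sq a]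
  have := mul_le_mul_of_nonneg_left h (show 0 ≤ b ^ 3 by positivity)
  linarith

/-- Among vectors with given sum and given `∑ x log x`, bounded by `a`, the vector
`(a, b, …, b)` has the largest sum of squares. -/
lemma sum_sq_le_of_sum_mul_log_eq {k : ℕ} {p : Fin (k + 1) → ℝ} {a b : ℝ}
    (hp : ∀ i, 0 ≤ p i) (hps : ∑ i, p i = 1) (hb : 0 ≤ b) (hba : b ≤ a) (hab : a + k * b = 1)
    (hpa : ∀ i, p i ≤ a)
    (hent : ∑ i, p i * log (p i) = a * log a + k * (b * log b)) :
    ∑ i, p i ^ 2 ≤ a ^ 2 + k * b ^ 2 := by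
  have htriv : ∑ i, p i ^ 2 ≤ a := by
    calc ∑ i, p i ^ 2 ≤ ∑ i, a * p i := by
          refine Finset.sum_le_sum fun i _ => ?_
          rw [sq]
          exact mul_le_mul_of_nonneg_right (hpa i) (hp i)
      _ = a := by rw [← Finset.mul_sum, hps, mul_one]
  rcases hba.eq_or_lt with rfl | hlt
  · calc _ ≤ b := htriv
      _ = b * (b + k * b) := by rw [hab, mul_one]
      _ = _ := by ring
  rcases hb.eq_or_lt with rfl | hb
  · have : a = 1 := by linarith
    subst this
    simpa using htriv
  have hpos : 0 < a * log a - a * log b - a + b := by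
    have ha : 0 < a := hb.trans hlt
    have h := Real.log_lt_sub_one_of_pos (div_pos hb ha) ((div_lt_one ha).2 hlt).ne
    rw [Real.log_div hb.ne' ha.ne'] at h
    have h2 := mul_lt_mul_of_pos_left h ha
    have h3 : a * (b / a - 1) = b - a := by field_simp
    linarith
  have h := Finset.sum_le_sum fun i (_ : i ∈ Finset.univ) =>
    sub_sq_mul_le_sub_sq_mul hb hlt (hp i) (hpa i)
  rw [← Finset.sum_mul, ← Finset.mul_sum] at h
  have e1 : ∑ i, (p i * log (p i) - p i * log b - p i + b)
      = a * log a - a * log b - a + b := by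
    rw [Finset.sum_add_distrib, Finset.sum_sub_distrib, Finset.sum_sub_distrib, hent,
      ← Finset.sum_mul, hps]
    simp only [Finset.sum_const, Finset.card_univ, Fintype.card_fin, nsmul_eq_mul, Nat.cast_add,
      Nat.cast_one]
    linear_combination (1 + log b) * hab
  rw [e1] at h
  have h := le_of_mul_le_mul_right h hpos
  have e2 : ∑ i, (p i - b) ^ 2 = ∑ i, p i ^ 2 - 2 * b + (k + 1) * b ^ 2 := by
    have : ∀ i, (p i - b) ^ 2 = p i ^ 2 - 2 * b * p i + b ^ 2 := fun i => by ring
    simp_rw [this]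
    rw [Finset.sum_add_distrib, Finset.sum_sub_distrib, ← Finset.mul_sum, hps]
    simp
  rw [e2] at h
  have : (a - b) ^ 2 + 2 * b - (k + 1) * b ^ 2 = a ^ 2 + k * b ^ 2 := by
    linear_combination (-2 * b) * hab
  linarith

/-- Averaging all coordinates but one decreases `∑ x log x`. -/
lemma mul_log_add_card_mul_le {k : ℕ} (hk : 1 ≤ k) {p : Fin (k + 1) → ℝ}
    (hp : ∀ i, 0 ≤ p i) (hps : ∑ i, p i = 1) (j : Fin (k + 1)) :
    p j * log (p j) + k * ((1 - p j) / k * log ((1 - p j) / k)) ≤ ∑ i, p i * log (p i) := by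
  have hk0 : (0 : ℝ) < k := by exact_mod_cast hk
  rw [Fin.sum_univ_succAbove _ j] at hps ⊢
  have h := Real.convexOn_mul_log.map_sum_le (t := Finset.univ) (w := fun _ : Fin k => (k : ℝ)⁻¹)
    (p := fun i => p (j.succAbove i)) (fun _ _ => by positivity) (by simp [hk0.ne'])
    (fun i _ => hp _)
  simp only [smul_eq_mul, ← Finset.mul_sum] at h
  rw [show ∑ i, p (j.succAbove i) = 1 - p j by linarith, ← div_eq_inv_mul] at h
  have := mul_le_mul_of_nonneg_left h hk0.le
  rw [mul_inv_cancel_left₀ hk0.ne'] at this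
  linarith

theorem H2_lower_bound_given_H1
    (n : ℕ) (hn : 2 ≤ n)
    (p : Fin n → ℝ) (hp : ∀ i, 0 ≤ p i) (hps : ∑ i, p i = 1) :
    ∃ s ∈ Set.Icc (0 : ℝ) 1,
      renyiH 1 (fun i => s * unif n n i + (1 - s) * unif n 1 i) = renyiH 1 p ∧
      renyiH 2 (fun i => s * unif n n i + (1 - s) * unif n 1 i) ≤ renyiH 2 p := by
  obtain ⟨k, rfl⟩ : ∃ k, n = k + 1 := ⟨n - 1, by omega⟩
  have hk : 1 ≤ k := by omega
  have hk0 : (0 : ℝ) < k := by exact_mod_cast hk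
  have hk1 : (0 : ℝ) < k + 1 := by linarith
  obtain ⟨j, hj⟩ := Finite.exists_max p
  have hj1 : p j ≤ 1 := hps ▸ Finset.single_le_sum (fun i _ => hp i) (Finset.mem_univ j)
  have hjn : 1 ≤ (k + 1) * p j := by
    have h := Finset.sum_le_sum fun i (_ : i ∈ Finset.univ) => hj i
    rw [hps] at h
    simpa using h
  have hsum : ∀ (s : ℝ) (f : ℝ → ℝ),
      ∑ i, f (s * unif (k + 1) (k + 1) i + (1 - s) * unif (k + 1) 1 i)
        = f (s / (k + 1) + (1 - s)) + k * f (s / (k + 1)) := by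
    intro s f
    rw [Fin.sum_univ_succ]
    simp [unif, div_eq_mul_inv]
  set F : ℝ → ℝ := fun s => (s / (k + 1) + (1 - s)) * log (s / (k + 1) + (1 - s))
    + k * (s / (k + 1) * log (s / (k + 1))) with hF
  have hFc : Continuous F := by
    have h1 := Real.continuous_mul_log.comp
      (show Continuous fun s : ℝ => s / (k + 1) + (1 - s) by fun_prop)
    have h2 := Real.continuous_mul_log.comp
      (show Continuous fun s : ℝ => s / ((k : ℝ) + 1) by fun_prop)
    exact h1.add (h2.const_mul _)
  set s₀ : ℝ := (1 - p j) * (k + 1) / k with hs₀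
  have hs₀0 : 0 ≤ s₀ := div_nonneg (mul_nonneg (by linarith) hk1.le) hk0.le
  have hs₀1 : s₀ ≤ 1 := by
    rw [hs₀, div_le_one hk0]
    linarith
  have hb₀ : s₀ / (k + 1) = (1 - p j) / k := by
    rw [hs₀]
    field_simp
  have ha₀ : s₀ / (k + 1) + (1 - s₀) = p j := by
    rw [hs₀]
    field_simp
    ring
  have hF₀ : F s₀ ≤ ∑ i, p i * log (p i) := by
    simp only [hF]
    rw [ha₀, hb₀]
    exact mul_log_add_card_mul_le hk hp hps j
  have hF0 : ∑ i, p i * log (p i) ≤ F 0 := by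
    simp only [hF, zero_div, sub_zero, zero_add, log_one, mul_zero, log_zero, add_zero]
    exact Finset.sum_nonpos fun i _ =>
      Real.mul_log_nonpos (hp i) ((hj i).trans hj1)
  obtain ⟨s, ⟨hs0, hss⟩, hs⟩ := intermediate_value_Icc' hs₀0 hFc.continuousOn ⟨hF₀, hF0⟩
  have ha : p j ≤ s / (k + 1) + (1 - s) := by
    rw [← ha₀]
    have e : ∀ x : ℝ, x / (k + 1) + (1 - x) = 1 - x * (k / (k + 1)) := by
      intro x
      field_simp
      ring
    rw [e, e]
    have := mul_le_mul_of_nonneg_right hss (show (0 : ℝ) ≤ k / (k + 1) by positivity)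
    linarith
  have hs1 : s ≤ 1 := hss.trans hs₀1
  refine ⟨s, ⟨hs0, hs1⟩, ?_, ?_⟩
  · simp only [renyiH, if_true]
    rw [hsum s (fun x => x * log x), ← hs]
  · have hsq := sum_sq_le_of_sum_mul_log_eq hp hps (div_nonneg hs0 hk1.le)
      (by linarith) (by field_simp; ring) (fun i => (hj i).trans ha) hs.symm
    have hpos : 0 < ∑ i, p i ^ 2 := by
      have hjpos : 0 < p j := pos_of_mul_pos_right (by linarith) hk1.le
      exact (pow_pos hjpos 2).trans_le
        (Finset.single_le_sum (f := fun i => p i ^ 2) (fun i _ => sq_nonneg _) (Finset.mem_univ j))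
    have hlog := Real.log_le_log hpos hsq
    simp only [renyiH, Real.rpow_two]
    rw [hsum s (fun x => x ^ 2)]
    norm_num
    linarith
end

section
/- Let 0 < α_1 < α_2 be real numbers and let P be a probability vector on n points, n ≥ 2. Then there exists s ∈ [0,1] such that the mixture Q = s·U_n + (1−s)·U_1 satisfies H_{α_1}(Q) = H_{α_1}(P) and H_{α_2}(P) ≥ H_{α_2}(Q). That is, among probability vectors on n points the lower bound on H_{α_2} given H_{α_1} is attained by a mixture of the uniform distribution on n points and a point mass. -/
open Real Filter

lemma strictConvexOn_of_hasDerivAt2_pos {D : Set ℝ} (hD : Convex ℝ D) {f f' f'' : ℝ → ℝ}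
    (hf : ContinuousOn f D) (hf' : ∀ x ∈ interior D, HasDerivAt f (f' x) x)
    (hf'' : ∀ x ∈ interior D, HasDerivAt f' (f'' x) x) (hpos : ∀ x ∈ interior D, 0 < f'' x) :
    StrictConvexOn ℝ D f := by
  refine StrictMonoOn.strictConvexOn_of_deriv hD hf ?_
  have hmono : StrictMonoOn f' (interior D) := by
    refine strictMonoOn_of_hasDerivWithinAt_pos hD.interior
      (fun x hx => (hf'' x hx).continuousAt.continuousWithinAt)
      (fun x hx => (hf'' x (interior_subset hx)).hasDerivWithinAt)
      (fun x hx => hpos x (interior_subset hx))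
  exact hmono.congr fun x hx => (hf' x hx).deriv.symm

lemma StrictConvexOn.tangent_lt {D : Set ℝ} {f : ℝ → ℝ} (hf : StrictConvexOn ℝ D f)
    {u v c : ℝ} (hu : u ∈ D) (hv : v ∈ D) (huv : u ≠ v) (hc : HasDerivAt f c v) :
    f v + c * (u - v) < f u := by
  rcases lt_or_gt_of_ne huv with h | h
  · have := hf.slope_lt_of_hasDerivAt hu hv h hc
    rw [slope_def_field, div_lt_iff₀ (by linarith)] at this
    linarith
  · have := hf.lt_slope_of_hasDerivAt hv hu h hc
    rw [slope_def_field, lt_div_iff₀ (by linarith)] at this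
    linarith

/-- The convex function with second derivative `α * t ^ (α - 2)` vanishing at `0` and `1`; its
sum over a probability vector is the negative of the Tsallis entropy of order `α`. -/
noncomputable def tsallisFun (α t : ℝ) : ℝ :=
  if α = 1 then t * Real.log t else (t ^ α - t) / (α - 1)

noncomputable def tsallisDeriv (α t : ℝ) : ℝ :=
  if α = 1 then Real.log t + 1 else (α * t ^ (α - 1) - 1) / (α - 1)

lemma tsallisFun_zero {α : ℝ} (hα : 0 < α) : tsallisFun α 0 = 0 := by
  unfold tsallisFun
  split_ifs <;> simp [Real.zero_rpow hα.ne']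

lemma tsallisFun_one (α : ℝ) : tsallisFun α 1 = 0 := by
  unfold tsallisFun
  split_ifs <;> simp

lemma continuous_tsallisFun {α : ℝ} (hα : 0 < α) : Continuous (tsallisFun α) := by
  unfold tsallisFun
  split_ifs
  · exact Real.continuous_mul_log
  · exact ((Real.continuous_rpow_const hα.le).sub continuous_id).div_const _

lemma hasDerivAt_tsallisFun (α : ℝ) {t : ℝ} (ht : 0 < t) :
    HasDerivAt (tsallisFun α) (tsallisDeriv α t) t := by
  unfold tsallisFun tsallisDeriv
  split_ifs
  · exact Real.hasDerivAt_mul_log ht.ne'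
  · exact ((Real.hasDerivAt_rpow_const (Or.inl ht.ne')).sub (hasDerivAt_id t)).div_const _

lemma hasDerivAt_tsallisDeriv (α : ℝ) {t : ℝ} (ht : 0 < t) :
    HasDerivAt (tsallisDeriv α) (α * t ^ (α - 2)) t := by
  unfold tsallisDeriv
  split_ifs with h
  · subst h
    refine ((Real.hasDerivAt_log ht.ne').add_const (1 : ℝ)).congr_deriv ?_
    norm_num [Real.rpow_neg_one]
  · have h1 : α - 1 ≠ 0 := sub_ne_zero.2 h
    refine ((((Real.hasDerivAt_rpow_const (p := α - 1) (Or.inl ht.ne')).const_mul α).sub_const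
      (1 : ℝ)).div_const (α - 1)).congr_deriv ?_
    rw [show α - 1 - 1 = α - 2 by ring]
    field_simp

lemma strictConvexOn_tsallisFun {α : ℝ} (hα : 0 < α) :
    StrictConvexOn ℝ (Set.Ici 0) (tsallisFun α) := by
  refine strictConvexOn_of_hasDerivAt2_pos (convex_Ici 0) (continuous_tsallisFun hα).continuousOn
    (f' := tsallisDeriv α) (f'' := fun t => α * t ^ (α - 2)) ?_ ?_ ?_ <;>
    rw [interior_Ici] <;> intro t ht
  · exact hasDerivAt_tsallisFun α ht
  · exact hasDerivAt_tsallisDeriv α ht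
  · exact mul_pos hα (Real.rpow_pos_of_pos ht _)

lemma tsallisFun_tangent_lt {α : ℝ} (hα : 0 < α) {u v : ℝ} (hu : 0 ≤ u) (hv : 0 < v)
    (huv : u ≠ v) : tsallisFun α v + tsallisDeriv α v * (u - v) < tsallisFun α u :=
  (strictConvexOn_tsallisFun hα).tangent_lt hu hv.le huv (hasDerivAt_tsallisFun α hv)

lemma tsallisFun_tangent_le {α : ℝ} (hα : 0 < α) {u v : ℝ} (hu : 0 ≤ u) (hv : 0 < v) :
    tsallisFun α v + tsallisDeriv α v * (u - v) ≤ tsallisFun α u := by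
  rcases eq_or_ne u v with rfl | h
  · simp
  · exact (tsallisFun_tangent_lt hα hu hv h).le

lemma tsallisFun_nonpos {α : ℝ} (hα : 0 < α) {t : ℝ} (ht : 0 ≤ t) (ht1 : t ≤ 1) :
    tsallisFun α t ≤ 0 := by
  have := (strictConvexOn_tsallisFun hα).convexOn.le_max_of_mem_Icc (x := 0) (y := 1) (z := t)
    (by simp) (by simp) ⟨ht, ht1⟩
  simpa [tsallisFun_zero hα, tsallisFun_one] using this

lemma renyiH_le_of_sum_tsallisFun_le {n : ℕ} (α : ℝ) {p q : Fin n → ℝ}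
    (hp : ∀ i, 0 ≤ p i) (hps : ∑ i, p i = 1) (hq : ∀ i, 0 ≤ q i) (hqs : ∑ i, q i = 1)
    (h : ∑ i, tsallisFun α (p i) ≤ ∑ i, tsallisFun α (q i)) : renyiH α q ≤ renyiH α p := by
  unfold renyiH
  unfold tsallisFun at h
  have pos : ∀ r : Fin n → ℝ, (∀ i, 0 ≤ r i) → ∑ i, r i = 1 → 0 < ∑ i, r i ^ α := by
    intro r hr hrs
    have h0 : ∃ i ∈ Finset.univ, r i ≠ 0 := Finset.exists_ne_zero_of_sum_ne_zero (by simp [hrs])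
    obtain ⟨i, -, hi⟩ := h0
    exact Finset.sum_pos' (fun j _ => Real.rpow_nonneg (hr j) _)
      ⟨i, Finset.mem_univ i, Real.rpow_pos_of_pos (lt_of_le_of_ne (hr i) hi.symm) _⟩
  split_ifs at h ⊢ with hα
  · exact neg_le_neg h
  · rw [← Finset.sum_div, ← Finset.sum_div, Finset.sum_sub_distrib, Finset.sum_sub_distrib,
      hps, hqs] at h
    rcases lt_or_gt_of_ne hα with h1 | h1
    · rw [div_le_div_right_of_neg (by linarith)] at h
      exact mul_le_mul_of_nonneg_left (Real.log_le_log (pos q hq hqs) (by linarith))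
        (one_div_nonneg.2 (by linarith))
    · rw [div_le_div_iff_of_pos_right (by linarith)] at h
      exact mul_le_mul_of_nonpos_left (Real.log_le_log (pos p hp hps) (by linarith))
        (one_div_nonpos.2 (by linarith))

/-- On `[0, x]`, `tsallisFun β` lies below the combination of `tsallisFun α` and an affine function
that is tangent to it at `y` and meets it at `x`. -/
lemma exists_tsallisFun_le {α β x y : ℝ} (hα : 0 < α) (hαβ : α < β) (hy : 0 < y) (hyx : y < x) :
    ∃ a b c : ℝ, tsallisFun β y = a * tsallisFun α y + b * y + c ∧
      tsallisFun β x = a * tsallisFun α x + b * x + c ∧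
      ∀ t ∈ Set.Icc 0 x, tsallisFun β t ≤ a * tsallisFun α t + b * t + c := by
  have hβ : 0 < β := hα.trans hαβ
  have hx : 0 < x := hy.trans hyx
  have hA := tsallisFun_tangent_lt hα hx.le hy hyx.ne'
  have hB := tsallisFun_tangent_lt hβ hx.le hy hyx.ne'
  obtain ⟨a, ha, hax⟩ : ∃ a : ℝ, 0 < a ∧
      tsallisFun β x - (tsallisFun β y + tsallisDeriv β y * (x - y)) =
        a * (tsallisFun α x - (tsallisFun α y + tsallisDeriv α y * (x - y))) :=
    ⟨_, div_pos (sub_pos.2 hB) (sub_pos.2 hA), (div_mul_cancel₀ _ (sub_pos.2 hA).ne').symm⟩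
  set b := tsallisDeriv β y - a * tsallisDeriv α y with hb
  set c := tsallisFun β y - a * tsallisFun α y - b * y with hc
  set h : ℝ → ℝ := fun t => tsallisFun β t - a * tsallisFun α t - b * t - c with hh
  set h' : ℝ → ℝ := fun t => tsallisDeriv β t - a * tsallisDeriv α t - b with hh'
  have hhy : h y = 0 := by simp only [hh, hc]; ring
  have hhx : h x = 0 := by simp only [hh, hc, hb]; linear_combination hax
  have hcont : Continuous h :=
    (((continuous_tsallisFun hβ).sub ((continuous_tsallisFun hα).const_mul a)).sub
      (continuous_id.const_mul b)).sub continuous_const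
  have hd : ∀ t, 0 < t → HasDerivAt h (h' t) t := fun t ht =>
    ((((hasDerivAt_tsallisFun β ht).sub ((hasDerivAt_tsallisFun α ht).const_mul a)).sub
      ((hasDerivAt_id t).const_mul b)).sub_const c).congr_deriv (by simp [hh'])
  have hdy : HasDerivAt h 0 y := by
    refine (hd y hy).congr_deriv ?_
    simp only [hh', hb]; ring
  have hd' : ∀ t, 0 < t → HasDerivAt h' (β * t ^ (β - 2) - a * (α * t ^ (α - 2))) t :=
    fun t ht => ((hasDerivAt_tsallisDeriv β ht).sub
      ((hasDerivAt_tsallisDeriv α ht).const_mul a)).sub_const b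
  have hfac : ∀ t, 0 < t → β * t ^ (β - 2) - a * (α * t ^ (α - 2)) =
      t ^ (α - 2) * β * (t ^ (β - α) - a * α / β) := fun t ht => by
    rw [show β - 2 = (α - 2) + (β - α) by ring, Real.rpow_add ht]
    field_simp
  have hpos : 0 < a * α / β := by positivity
  set τ := (a * α / β) ^ (β - α)⁻¹ with hτ
  have hτ0 : 0 < τ := Real.rpow_pos_of_pos hpos _
  have hτp : τ ^ (β - α) = a * α / β := Real.rpow_inv_rpow hpos.le (by linarith)
  have hconv : StrictConvexOn ℝ (Set.Ici τ) h := by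
    refine strictConvexOn_of_hasDerivAt2_pos (convex_Ici τ) hcont.continuousOn (f' := h')
      (f'' := fun t => β * t ^ (β - 2) - a * (α * t ^ (α - 2))) ?_ ?_ ?_ <;>
      rw [interior_Ici] <;> intro t (ht : τ < t)
    · exact hd t (hτ0.trans ht)
    · exact hd' t (hτ0.trans ht)
    · have ht0 := hτ0.trans ht
      rw [hfac t ht0, ← hτp]
      exact mul_pos (mul_pos (Real.rpow_pos_of_pos ht0 _) hβ)
        (sub_pos.2 (Real.rpow_lt_rpow hτ0.le ht (by linarith)))
  have hconc : StrictConvexOn ℝ (Set.Icc 0 τ) (-h) := by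
    refine strictConvexOn_of_hasDerivAt2_pos (convex_Icc 0 τ) hcont.neg.continuousOn (f' := -h')
      (f'' := fun t => -(β * t ^ (β - 2) - a * (α * t ^ (α - 2)))) ?_ ?_ ?_ <;>
      rw [interior_Icc] <;> rintro t ⟨ht0, ht⟩
    · exact (hd t ht0).neg
    · exact (hd' t ht0).neg
    · rw [hfac t ht0, ← hτp]
      exact neg_pos.2 (mul_neg_of_pos_of_neg (mul_pos (Real.rpow_pos_of_pos ht0 _) hβ)
        (sub_neg.2 (Real.rpow_lt_rpow ht0.le ht (by linarith))))
  have hyτ : y < τ := by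
    by_contra! hle
    have := hconv.tangent_lt (hle.trans hyx.le) hle hyx.ne' hdy
    linarith
  have hτx : τ < x := by
    by_contra! hle
    have := hconc.tangent_lt ⟨hx.le, hle⟩ ⟨hy.le, hyτ.le⟩ hyx.ne' hdy.neg
    simp [hhx, hhy] at this
  have hleft : ∀ t, 0 ≤ t → t ≤ τ → h t ≤ 0 := fun t ht0 ht => by
    rcases eq_or_ne t y with rfl | hne
    · exact hhy.le
    · have := hconc.tangent_lt ⟨ht0, ht⟩ ⟨hy.le, hyτ.le⟩ hne hdy.neg
      simp [hhy] at this
      exact this.le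
  have hle : ∀ t ∈ Set.Icc 0 x, h t ≤ 0 := fun t ⟨ht0, htx⟩ => by
    rcases le_total t τ with ht | ht
    · exact hleft t ht0 ht
    · refine (hconv.convexOn.le_max_of_mem_Icc (x := τ) (y := x) Set.self_mem_Ici hτx.le
        ⟨ht, htx⟩).trans ?_
      exact max_le (hleft τ hτ0.le le_rfl) hhx.le
  refine ⟨a, b, c, ?_, ?_, fun t ht => ?_⟩
  · linarith [hhy]
  · linarith [hhx]
  · linarith [hle t ht]

/-- A probability vector whose largest coordinate exceeds `x` has a larger sum of `tsallisFun`
than the vector with one coordinate `x` and the `m` others equal to `y`. -/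
lemma sum_tsallisFun_lt_of_lt {m : ℕ} {α x y : ℝ} (hα : 0 < α) (hy : 0 < y) (hyx : y ≤ x)
    (hxy : x + m * y = 1) {p : Fin (m + 1) → ℝ} (hp : ∀ i, 0 ≤ p i) (hps : ∑ i, p i = 1)
    {j : Fin (m + 1)} (hj : x < p j) :
    tsallisFun α x + m * tsallisFun α y < ∑ i, tsallisFun α (p i) := by
  have hx : 0 < x := hy.trans_le hyx
  have hmono : tsallisDeriv α y ≤ tsallisDeriv α x := by
    rcases hyx.eq_or_lt with rfl | hlt
    · rfl
    · have h1 := tsallisFun_tangent_le hα hx.le hy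
      have h2 := tsallisFun_tangent_le hα hy.le hx
      nlinarith
  rw [Fin.sum_univ_succAbove _ j] at hps ⊢
  have h1 := tsallisFun_tangent_lt hα (hp j) hx hj.ne'
  have h2 : ∑ i, (tsallisFun α y + tsallisDeriv α y * (p (j.succAbove i) - y)) ≤
      ∑ i, tsallisFun α (p (j.succAbove i)) :=
    Finset.sum_le_sum fun i _ => tsallisFun_tangent_le hα (hp _) hy
  rw [Finset.sum_add_distrib, ← Finset.mul_sum, Finset.sum_sub_distrib] at h2
  simp only [Finset.sum_const, Finset.card_univ, Fintype.card_fin, nsmul_eq_mul] at h2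
  have h3 : ∑ i, p (j.succAbove i) - m * y = -(p j - x) := by linarith
  rw [h3] at h2
  nlinarith

lemma sum_tsallisFun_le_of_eq {m : ℕ} {α β x y : ℝ} (hα : 0 < α) (hαβ : α < β) (hy : 0 ≤ y)
    (hyx : y ≤ x) (hxy : x + m * y = 1) {p : Fin (m + 1) → ℝ} (hp : ∀ i, 0 ≤ p i)
    (hps : ∑ i, p i = 1)
    (heq : ∑ i, tsallisFun α (p i) = tsallisFun α x + m * tsallisFun α y) :
    ∑ i, tsallisFun β (p i) ≤ tsallisFun β x + m * tsallisFun β y := by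
  have hβ := hα.trans hαβ
  rcases hy.eq_or_lt with rfl | hy
  · have hx : x = 1 := by simpa using hxy
    rw [hx, tsallisFun_one, tsallisFun_zero hβ, mul_zero, add_zero]
    exact Finset.sum_nonpos fun i _ => tsallisFun_nonpos hβ (hp i)
      (hps ▸ Finset.single_le_sum (fun j _ => hp j) (Finset.mem_univ i))
  have hle : ∀ i, p i ≤ x := fun i => by
    by_contra! h
    exact (sum_tsallisFun_lt_of_lt hα hy hyx hxy hp hps h).ne' heq
  rcases hyx.eq_or_lt with rfl | hlt
  · have hall : ∀ i ∈ Finset.univ, p i = y := by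
      refine (Finset.sum_eq_sum_iff_of_le fun i _ => hle i).1 ?_
      simp only [Finset.sum_const, Finset.card_univ, Fintype.card_fin, nsmul_eq_mul]
      push_cast
      linarith
    rw [Finset.sum_congr rfl fun i hi => by rw [hall i hi]]
    simp only [Finset.sum_const, Finset.card_univ, Fintype.card_fin, nsmul_eq_mul]
    push_cast
    linarith
  · obtain ⟨a, b, c, hy', hx', hab⟩ := exists_tsallisFun_le hα hαβ hy hlt
    calc ∑ i, tsallisFun β (p i) ≤ ∑ i, (a * tsallisFun α (p i) + b * p i + c) :=
          Finset.sum_le_sum fun i _ => hab _ ⟨hp i, hle i⟩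
      _ = a * (tsallisFun α x + m * tsallisFun α y) + b * 1 + (m + 1) * c := by
          rw [Finset.sum_add_distrib, Finset.sum_add_distrib, ← Finset.mul_sum, ← Finset.mul_sum,
            heq, hps]
          simp
      _ = tsallisFun β x + m * tsallisFun β y := by
          rw [hx', hy']; linear_combination (-b) * hxy

theorem renyi_lower_bound_two_orders
    (α₁ α₂ : ℝ) (hα₁ : 0 < α₁) (hα₁₂ : α₁ < α₂)
    (n : ℕ) (hn : 2 ≤ n)
    (p : Fin n → ℝ) (hp : ∀ i, 0 ≤ p i) (hps : ∑ i, p i = 1) :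
    ∃ s ∈ Set.Icc (0 : ℝ) 1,
      renyiH α₁ (fun i => s * unif n n i + (1 - s) * unif n 1 i) = renyiH α₁ p ∧
      renyiH α₂ (fun i => s * unif n n i + (1 - s) * unif n 1 i) ≤ renyiH α₂ p := by
  have hα₂ := hα₁.trans hα₁₂
  obtain ⟨m, rfl⟩ : ∃ m, n = m + 1 := ⟨n - 1, by omega⟩
  have hm : (0 : ℝ) < m + 1 := by positivity
  set y : ℝ → ℝ := fun s => s * (m + 1 : ℝ)⁻¹ with hy
  set x : ℝ → ℝ := fun s => s * (m + 1 : ℝ)⁻¹ + (1 - s) with hx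
  set q : ℝ → Fin (m + 1) → ℝ :=
    fun s i => s * unif (m + 1) (m + 1) i + (1 - s) * unif (m + 1) 1 i with hq
  have hq0 : ∀ s, q s 0 = x s := fun s => by simp [hq, hx, unif]
  have hqsucc : ∀ s (i : Fin m), q s i.succ = y s := fun s i => by simp [hq, hy, unif]
  have hsum : ∀ (F : ℝ → ℝ) s, ∑ i, F (q s i) = F (x s) + m * F (y s) := fun F s => by
    simp [Fin.sum_univ_succ, hq0, hqsucc]
  have hxy : ∀ s, x s + m * y s = 1 := fun s => by
    simp only [hx, hy]; field_simp; ring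
  have hqs : ∀ s, ∑ i, q s i = 1 := fun s => (hsum id s).trans (hxy s)
  obtain ⟨s, hs, hs_eq⟩ : ∃ s ∈ Set.Icc (0 : ℝ) 1,
      tsallisFun α₁ (x s) + m * tsallisFun α₁ (y s) = ∑ i, tsallisFun α₁ (p i) := by
    have hcont : Continuous fun s => tsallisFun α₁ (x s) + m * tsallisFun α₁ (y s) :=
      ((continuous_tsallisFun hα₁).comp (by fun_prop)).add
        (((continuous_tsallisFun hα₁).comp (by fun_prop)).const_mul _)
    refine intermediate_value_Icc' zero_le_one hcont.continuousOn ⟨?_, ?_⟩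
    · have h1 : ∑ i, (tsallisFun α₁ (m + 1 : ℝ)⁻¹ +
          tsallisDeriv α₁ (m + 1 : ℝ)⁻¹ * (p i - (m + 1 : ℝ)⁻¹)) ≤ ∑ i, tsallisFun α₁ (p i) :=
        Finset.sum_le_sum fun i _ => tsallisFun_tangent_le hα₁ (hp i) (by positivity)
      rw [Finset.sum_add_distrib, ← Finset.mul_sum, Finset.sum_sub_distrib, hps] at h1
      simp only [Finset.sum_const, Finset.card_univ, Fintype.card_fin, nsmul_eq_mul,
        Nat.cast_add, Nat.cast_one, mul_inv_cancel₀ hm.ne', sub_self, mul_zero, add_zero] at h1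
      simp only [hx, hy, sub_self, add_zero, one_mul]
      linarith
    · simp only [hx, hy, zero_mul, sub_zero, zero_add, tsallisFun_one, tsallisFun_zero hα₁,
        mul_zero, add_zero]
      exact Finset.sum_nonpos fun i _ => tsallisFun_nonpos hα₁ (hp i)
        (hps ▸ Finset.single_le_sum (fun j _ => hp j) (Finset.mem_univ i))
  have hy0 : 0 ≤ y s := mul_nonneg hs.1 (by positivity)
  have hyx : y s ≤ x s := by simp only [hx, hy]; linarith [hs.2]
  have hq_nonneg : ∀ i, 0 ≤ q s i := Fin.cases (by rw [hq0]; exact hy0.trans hyx)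
    fun i => by rw [hqsucc]; exact hy0
  have heq : ∑ i, tsallisFun α₁ (q s i) = ∑ i, tsallisFun α₁ (p i) :=
    (hsum _ s).trans hs_eq
  refine ⟨s, hs, le_antisymm ?_ ?_, ?_⟩
  · exact renyiH_le_of_sum_tsallisFun_le α₁ hp hps hq_nonneg (hqs s) heq.ge
  · exact renyiH_le_of_sum_tsallisFun_le α₁ hq_nonneg (hqs s) hp hps heq.le
  · refine renyiH_le_of_sum_tsallisFun_le α₂ hp hps hq_nonneg (hqs s) ?_
    rw [hsum]
    exact sum_tsallisFun_le_of_eq hα₁ hα₁₂ hy0 hyx (hxy s) hp hps hs_eq.symm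
end

section
/- Let 1 < α_1 < α_2 be real numbers. Then for every h > 0 and every ε > 0 there exist an integer n ≥ 2 and a probability vector P on n points such that H_{α_1}(P) = h and H_{α_2}(P) < (α_2/(α_2−1))·((α_1−1)/α_1)·h + ε. That is, with no restriction on the number of points, the lower bound H_{α_2}(P) > (α_2/(α_2−1))·((α_1−1)/α_1)·H_{α_1}(P) is tight. -/
open Real Filter

/-- The power sum of the vector with one coordinate `t` and `m` coordinates `c`. -/
theorem sum_cons_const_rpow (m : ℕ) (t c α : ℝ) :
    ∑ i, (Fin.cons t (fun _ => c) : Fin (m + 1) → ℝ) i ^ α = t ^ α + m * c ^ α := by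
  simp [Fin.sum_univ_succ]

theorem tendsto_nat_mul_inv_rpow {α : ℝ} (hα : 1 < α) :
    Tendsto (fun m : ℕ => (m : ℝ) * (1 / (m : ℝ)) ^ α) atTop (nhds 0) := by
  have h := (tendsto_rpow_neg_atTop (sub_pos.2 hα)).comp tendsto_natCast_atTop_atTop
  refine h.congr' ?_
  filter_upwards [eventually_gt_atTop 0] with m hm
  have hm' : (0 : ℝ) < m := by exact_mod_cast hm
  rw [Function.comp_apply, one_div, Real.inv_rpow hm'.le, ← Real.rpow_neg hm'.le, neg_sub,
    sub_eq_add_neg, Real.rpow_add hm', Real.rpow_one]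

/-- If `s` is at least the power sum of the uniform vector on `m` points, then some vector
`(t, (1 - t) / m, …, (1 - t) / m)` has power sum exactly `s`. -/
theorem exists_rpow_add_eq {α s : ℝ} (hα : 0 < α) (hs1 : s ≤ 1) (m : ℕ)
    (hm : (m : ℝ) * (1 / (m : ℝ)) ^ α ≤ s) :
    ∃ t : ℝ, 0 ≤ t ∧ t ≤ 1 ∧ t ^ α + m * ((1 - t) / m) ^ α = s := by
  have hcont : ContinuousOn (fun t : ℝ => t ^ α + m * ((1 - t) / m) ^ α) (Set.Icc 0 1) := by
    have h1 : Continuous fun t : ℝ => t ^ α := Real.continuous_rpow_const hα.le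
    have h2 : Continuous fun t : ℝ => ((1 - t) / m) ^ α :=
      h1.comp ((continuous_const.sub continuous_id).div_const _)
    exact (h1.add (continuous_const.mul h2)).continuousOn
  have hs : s ∈ Set.Icc ((0 : ℝ) ^ α + m * ((1 - 0) / m) ^ α)
      ((1 : ℝ) ^ α + m * ((1 - 1) / m) ^ α) := by
    constructor
    · simpa [Real.zero_rpow hα.ne'] using hm
    · simpa [Real.zero_rpow hα.ne'] using hs1
  obtain ⟨t, ht, hts⟩ := intermediate_value_Icc zero_le_one hcont hs
  exact ⟨t, ht.1, ht.2, hts⟩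

theorem renyi_slope_lower_bound_tight
    (α₁ α₂ : ℝ) (hα₁ : 1 < α₁) (hα₁₂ : α₁ < α₂) :
    ∀ h > (0 : ℝ), ∀ ε > (0 : ℝ), ∃ n : ℕ, 2 ≤ n ∧ ∃ p : Fin n → ℝ,
      (∀ i, 0 ≤ p i) ∧ ∑ i, p i = 1 ∧ renyiH α₁ p = h ∧
      renyiH α₂ p < (α₂ / (α₂ - 1)) * ((α₁ - 1) / α₁) * h + ε := by
  intro h hh ε hε
  have h0 : 0 < α₁ := by linarith
  have h1 : 0 < α₁ - 1 := by linarith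
  have h2 : 0 < α₂ - 1 := by linarith
  have h20 : 0 < α₂ := by linarith
  set s : ℝ := Real.exp ((1 - α₁) * h) with hs_def
  have hs : 0 < s := Real.exp_pos _
  have hs1 : s ≤ 1 := Real.exp_le_one_iff.2 (by nlinarith)
  have hδ := tendsto_nat_mul_inv_rpow hα₁
  have hlim : Tendsto (fun m : ℕ => (1 / (1 - α₂)) *
      ((α₂ / α₁) * Real.log (s - (m : ℝ) * (1 / (m : ℝ)) ^ α₁))) atTop
      (nhds ((1 / (1 - α₂)) * ((α₂ / α₁) * Real.log (s - 0)))) :=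
    (((tendsto_const_nhds.sub hδ).log (by simpa using hs.ne')).const_mul _).const_mul _
  have hval : (1 / (1 - α₂)) * ((α₂ / α₁) * Real.log (s - 0)) =
      (α₂ / (α₂ - 1)) * ((α₁ - 1) / α₁) * h := by
    have : 1 - α₂ ≠ 0 := by linarith
    rw [sub_zero, hs_def, Real.log_exp]
    field_simp
    ring
  rw [hval] at hlim
  obtain ⟨m, hm, hms, hmlt⟩ := ((eventually_ge_atTop 1).and
    ((hδ.eventually (gt_mem_nhds hs)).and
      (hlim.eventually (gt_mem_nhds (lt_add_of_pos_right _ hε))))).exists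
  have hm0 : (0 : ℝ) < m := by exact_mod_cast hm
  obtain ⟨t, ht0, ht1, hts⟩ := exists_rpow_add_eq h0 hs1 m hms.le
  have hc : 0 ≤ (1 - t) / m := div_nonneg (by linarith) hm0.le
  refine ⟨m + 1, by omega, Fin.cons t fun _ => (1 - t) / m, ?_, ?_, ?_, ?_⟩
  · exact Fin.cases ht0 fun _ => hc
  · simp only [Fin.sum_univ_succ, Fin.cons_zero, Fin.cons_succ, Finset.sum_const,
      Finset.card_univ, Fintype.card_fin, nsmul_eq_mul]
    field_simp
    ring
  · rw [renyiH, if_neg hα₁.ne', sum_cons_const_rpow, hts, hs_def, Real.log_exp]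
    have : 1 - α₁ ≠ 0 := by linarith
    field_simp
  · rw [renyiH, if_neg (by linarith), sum_cons_const_rpow]
    refine lt_of_le_of_lt ?_ hmlt
    refine mul_le_mul_of_nonpos_left ?_ (one_div_nonpos.2 (by linarith))
    have hle : s - (m : ℝ) * (1 / (m : ℝ)) ^ α₁ ≤ t ^ α₁ := by
      have : (m : ℝ) * ((1 - t) / m) ^ α₁ ≤ m * (1 / (m : ℝ)) ^ α₁ := by
        gcongr
        linarith
      linarith
    have htpos : 0 < t := by
      refine ht0.lt_of_ne fun h => ?_
      rw [← h, Real.zero_rpow h0.ne'] at hle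
      linarith
    calc (α₂ / α₁) * Real.log (s - (m : ℝ) * (1 / (m : ℝ)) ^ α₁)
        ≤ (α₂ / α₁) * Real.log (t ^ α₁) := by
          gcongr
      _ = Real.log (t ^ α₂) := by
          rw [Real.log_rpow htpos, Real.log_rpow htpos]
          field_simp
      _ ≤ Real.log (t ^ α₂ + m * ((1 - t) / m) ^ α₂) :=
          Real.log_le_log (by positivity) (le_add_of_nonneg_right (by positivity))
end

section
/- Let 0 < α_1 < α_2 be real numbers with α_1 ≤ 1. Then for every h > 0 and every ε > 0 there exist an integer n ≥ 2 and a probability vector P on n points such that H_{α_1}(P) = h and H_{α_2}(P) < ε. That is, with no restriction on the number of points, the only lower bound on H_{α_2}(P) for fixed H_{α_1}(P) > 0 is the trivial bound H_{α_2}(P) > 0. -/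
open Real Filter

/-- The vector on `m + 1` points with one coordinate `1 - x`, the rest of the mass being spread
evenly. -/
noncomputable def spike (m : ℕ) (x : ℝ) : Fin (m + 1) → ℝ :=
  Fin.cons (1 - x) (fun _ => x / m)

lemma spike_nonneg {m : ℕ} {x : ℝ} (hx : x ∈ Set.Icc (0 : ℝ) (1 / 2)) (i : Fin (m + 1)) :
    0 ≤ spike m x i := by
  have h0 := hx.1
  have h1 := hx.2
  refine Fin.cases ?_ (fun j => ?_) i
  · simp only [spike, Fin.cons_zero]
    linarith
  · simp only [spike, Fin.cons_succ]
    positivity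

lemma sum_spike {m : ℕ} (hm : 0 < m) (x : ℝ) : ∑ i, spike m x i = 1 := by
  have : (m : ℝ) ≠ 0 := by positivity
  simp only [spike, Fin.sum_univ_succ, Fin.cons_zero, Fin.cons_succ, Finset.sum_const,
    Finset.card_univ, Fintype.card_fin, nsmul_eq_mul]
  field_simp
  ring

lemma renyiH_spike {m : ℕ} (hm : 0 < m) {x α : ℝ} (hx : 0 ≤ x) (hα : α ≠ 1) :
    renyiH α (spike m x)
      = (1 / (1 - α)) * log ((1 - x) ^ α + (m : ℝ) ^ (1 - α) * x ^ α) := by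
  have hm' : (0 : ℝ) < m := by positivity
  simp only [renyiH, if_neg hα, spike, Fin.sum_univ_succ, Fin.cons_zero, Fin.cons_succ,
    Finset.sum_const, Finset.card_univ, Fintype.card_fin, nsmul_eq_mul]
  rw [div_rpow hx hm'.le, rpow_sub hm', rpow_one]
  congr 3
  ring

lemma renyiH_one_spike {m : ℕ} (hm : 0 < m) (x : ℝ) :
    renyiH 1 (spike m x) = negMulLog (1 - x) + negMulLog x + x * log m := by
  have hm' : (m : ℝ) ≠ 0 := by positivity
  simp only [renyiH, if_true, spike, Fin.sum_univ_succ, Fin.cons_zero, Fin.cons_succ,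
    Finset.sum_const, Finset.card_univ, Fintype.card_fin, nsmul_eq_mul, negMulLog]
  rcases eq_or_ne x 0 with rfl | hx
  · simp
  · rw [log_div hx hm']
    field_simp
    ring

lemma tendsto_natCast_rpow_atTop {b : ℝ} (hb : 0 < b) :
    Tendsto (fun m : ℕ => (m : ℝ) ^ b) atTop atTop :=
  (tendsto_rpow_atTop hb).comp tendsto_natCast_atTop_atTop

lemma tendsto_natCast_rpow_neg {b : ℝ} (hb : 0 < b) :
    Tendsto (fun m : ℕ => (m : ℝ) ^ (-b)) atTop (nhds 0) :=
  (tendsto_rpow_neg_atTop hb).comp tendsto_natCast_atTop_atTop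

lemma eventually_exists_power_sum_eq {α C : ℝ} (h0 : 0 < α) (h1 : α < 1) (hC : 1 ≤ C) :
    ∀ᶠ m : ℕ in atTop, ∃ x ∈ Set.Icc (0 : ℝ) (1 / 2),
      (1 - x) ^ α + (m : ℝ) ^ (1 - α) * x ^ α = C := by
  have hlim := (tendsto_natCast_rpow_atTop (b := 1 - α) (by linarith)).atTop_mul_const
    (show (0 : ℝ) < (1 / 2) ^ α by positivity)
  filter_upwards [hlim.eventually_ge_atTop C] with m hm
  have hcont : ContinuousOn (fun x : ℝ => (1 - x) ^ α + (m : ℝ) ^ (1 - α) * x ^ α)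
      (Set.Icc 0 (1 / 2)) := by
    apply Continuous.continuousOn
    have hx : Continuous fun x : ℝ => x ^ α := continuous_id.rpow_const fun _ => Or.inr h0.le
    exact (hx.comp (continuous_const.sub continuous_id)).add (continuous_const.mul hx)
  refine intermediate_value_Icc (by norm_num) hcont ⟨?_, ?_⟩
  · simpa [zero_rpow h0.ne'] using hC
  · have : (0 : ℝ) ≤ (1 - 1 / 2) ^ α := by positivity
    linarith

lemma eventually_exists_shannon_eq {h : ℝ} (hh : 0 < h) :
    ∀ᶠ m : ℕ in atTop, ∃ x ∈ Set.Icc (0 : ℝ) (1 / 2),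
      negMulLog (1 - x) + negMulLog x + x * log m = h := by
  have hlim := (tendsto_log_atTop.comp tendsto_natCast_atTop_atTop).const_mul_atTop
    (show (0 : ℝ) < 1 / 2 by norm_num)
  filter_upwards [hlim.eventually_ge_atTop h] with m hm
  have hcont : ContinuousOn (fun x : ℝ => negMulLog (1 - x) + negMulLog x + x * log m)
      (Set.Icc 0 (1 / 2)) := by
    apply Continuous.continuousOn
    fun_prop
  refine intermediate_value_Icc (by norm_num) hcont ⟨?_, ?_⟩
  · simpa using hh.le
  · have h1 : 0 ≤ negMulLog (1 - 1 / 2 : ℝ) := negMulLog_nonneg (by norm_num) (by norm_num)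
    have h2 : 0 ≤ negMulLog (1 / 2 : ℝ) := negMulLog_nonneg (by norm_num) (by norm_num)
    simp only [Function.comp_apply] at hm ⊢
    linarith

lemma tendsto_renyiH_spike {α : ℝ} (hα : α ≠ 1) {x : ℕ → ℝ}
    (hx : ∀ᶠ m in atTop, 0 ≤ x m) (hx0 : Tendsto x atTop (nhds 0))
    (ht : Tendsto (fun m : ℕ => (m : ℝ) ^ (1 - α) * x m ^ α) atTop (nhds 0)) :
    Tendsto (fun m => renyiH α (spike m (x m))) atTop (nhds 0) := by
  have h1 : Tendsto (fun m => (1 - x m) ^ α) atTop (nhds 1) := by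
    simpa using (hx0.const_sub 1).rpow_const (p := α) (Or.inl (by norm_num))
  have h2 := ((h1.add ht).log (by norm_num)).const_mul (1 / (1 - α))
  simp only [add_zero, log_one, mul_zero] at h2
  refine h2.congr' ?_
  filter_upwards [hx, eventually_gt_atTop 0] with m hxm hm
  rw [renyiH_spike hm hxm hα]

lemma tendsto_renyiH_one_spike {x : ℕ → ℝ} (hx0 : Tendsto x atTop (nhds 0))
    (ht : Tendsto (fun m : ℕ => x m * log m) atTop (nhds 0)) :
    Tendsto (fun m => renyiH 1 (spike m (x m))) atTop (nhds 0) := by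
  have h1 : Tendsto (fun m => negMulLog (1 - x m)) atTop (nhds 0) := by
    simpa [Function.comp_def] using (continuous_negMulLog.tendsto _).comp (hx0.const_sub 1)
  have h2 : Tendsto (fun m => negMulLog (x m)) atTop (nhds 0) := by
    simpa [Function.comp_def] using (continuous_negMulLog.tendsto _).comp hx0
  have h3 := (h1.add h2).add ht
  simp only [add_zero] at h3
  refine h3.congr' ?_
  filter_upwards [eventually_gt_atTop 0] with m hm
  rw [renyiH_one_spike hm]

/-- For `α < 1`, spikes of constant order-`α` entropy have order-`β` entropy tending to `0` for
every `β > α`. -/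
lemma exists_spikes_of_lt_one {α β h : ℝ} (h0 : 0 < α) (h1 : α < 1) (hαβ : α < β) (hh : 0 < h) :
    ∃ x : ℕ → ℝ, (∀ᶠ m in atTop, x m ∈ Set.Icc (0 : ℝ) (1 / 2) ∧ renyiH α (spike m (x m)) = h) ∧
      Tendsto (fun m => renyiH β (spike m (x m))) atTop (nhds 0) := by
  set C := exp ((1 - α) * h) with hC
  have hCpos : 0 < C := exp_pos _
  have hα' : 0 < 1 - α := by linarith
  have hC1 : 1 ≤ C := one_le_exp (by positivity)
  obtain ⟨x, hx⟩ := (eventually_exists_power_sum_eq h0 h1 hC1).choice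
  have hmem : ∀ᶠ m in atTop, 0 ≤ x m := hx.mono fun m hm => hm.1.1
  set b := (1 - α) / α with hb
  have hbpos : 0 < b := by positivity
  have hle : ∀ᶠ m : ℕ in atTop, x m ≤ C ^ (1 / α) * (m : ℝ) ^ (-b) := by
    filter_upwards [hx, eventually_gt_atTop 0] with m ⟨⟨hx0, hx2⟩, he⟩ hm
    have hm' : (0 : ℝ) < m := by positivity
    have h2 : 0 ≤ (1 - x m) ^ α := rpow_nonneg (by linarith) _
    have h3 : ((m : ℝ) ^ (1 - α) * x m ^ α) ^ (1 / α) ≤ C ^ (1 / α) :=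
      rpow_le_rpow (by positivity) (by linarith) (by positivity)
    rw [mul_rpow (by positivity) (by positivity), ← rpow_mul hm'.le, ← rpow_mul hx0,
      mul_one_div_cancel h0.ne', rpow_one, mul_one_div, ← hb] at h3
    rw [rpow_neg hm'.le, ← div_eq_mul_inv, le_div_iff₀ (by positivity)]
    linarith
  have hx0 : Tendsto x atTop (nhds 0) := by
    have h2 := (tendsto_natCast_rpow_neg hbpos).const_mul (C ^ (1 / α))
    rw [mul_zero] at h2
    exact squeeze_zero' hmem hle h2
  refine ⟨x, ?_, ?_⟩
  · filter_upwards [hx, eventually_gt_atTop 0] with m ⟨hm1, he⟩ hm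
    refine ⟨hm1, ?_⟩
    rw [renyiH_spike hm hm1.1 h1.ne, he, hC, log_exp]
    field_simp
  · rcases eq_or_ne β 1 with rfl | hβ
    · refine tendsto_renyiH_one_spike hx0 ?_
      have h2 : Tendsto (fun m : ℕ => C ^ (1 / α) * (log m / (m : ℝ) ^ b)) atTop (nhds 0) := by
        simpa using (((isLittleO_log_rpow_atTop hbpos).tendsto_div_nhds_zero.comp
          tendsto_natCast_atTop_atTop).const_mul (C ^ (1 / α)))
      refine squeeze_zero' ?_ ?_ h2
      · filter_upwards [hmem] with m hm
        exact mul_nonneg hm (log_natCast_nonneg m)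
      · filter_upwards [hle] with m hm
        calc x m * log m ≤ C ^ (1 / α) * (m : ℝ) ^ (-b) * log m :=
              mul_le_mul_of_nonneg_right hm (log_natCast_nonneg m)
          _ = C ^ (1 / α) * (log m / (m : ℝ) ^ b) := by
              rw [rpow_neg (Nat.cast_nonneg m)]
              ring
    · refine tendsto_renyiH_spike hβ hmem hx0 ?_
      have hexp : 0 < β / α - 1 := by
        rw [sub_pos, one_lt_div h0]
        exact hαβ
      have h2 := (tendsto_natCast_rpow_neg hexp).const_mul ((C ^ (1 / α)) ^ β)
      rw [mul_zero] at h2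
      refine squeeze_zero' ?_ ?_ h2
      · filter_upwards [hmem] with m hm
        positivity
      · filter_upwards [hmem, hle, eventually_gt_atTop 0] with m hm hlem hm0
        have hm' : (0 : ℝ) < m := by positivity
        calc (m : ℝ) ^ (1 - β) * x m ^ β
            ≤ (m : ℝ) ^ (1 - β) * (C ^ (1 / α) * (m : ℝ) ^ (-b)) ^ β := by
              gcongr
              linarith
          _ = (C ^ (1 / α)) ^ β * (m : ℝ) ^ (-(β / α - 1)) := by
              rw [mul_rpow (by positivity) (by positivity), ← rpow_mul hm'.le, mul_left_comm,
                ← rpow_add hm']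
              congr 2
              rw [hb]
              field_simp
              ring

/-- Spikes of constant Shannon entropy have order-`β` entropy tending to `0` for every
`β > 1`. -/
lemma exists_spikes_of_one {β h : ℝ} (hβ : 1 < β) (hh : 0 < h) :
    ∃ x : ℕ → ℝ, (∀ᶠ m in atTop, x m ∈ Set.Icc (0 : ℝ) (1 / 2) ∧ renyiH 1 (spike m (x m)) = h) ∧
      Tendsto (fun m => renyiH β (spike m (x m))) atTop (nhds 0) := by
  obtain ⟨x, hx⟩ := (eventually_exists_shannon_eq hh).choice
  have hmem : ∀ᶠ m in atTop, 0 ≤ x m := hx.mono fun m hm => hm.1.1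
  have hx0 : Tendsto x atTop (nhds 0) := by
    have h2 : Tendsto (fun m : ℕ => h / log m) atTop (nhds 0) :=
      (tendsto_log_atTop.comp tendsto_natCast_atTop_atTop).const_div_atTop h
    refine squeeze_zero' hmem ?_ h2
    filter_upwards [hx, eventually_gt_atTop 1] with m ⟨⟨hx0, hx2⟩, he⟩ hm
    have h3 := negMulLog_nonneg hx0 (by linarith)
    have h4 := negMulLog_nonneg (x := 1 - x m) (by linarith) (by linarith)
    rw [le_div_iff₀ (log_pos (by exact_mod_cast hm))]
    linarith
  refine ⟨x, ?_, tendsto_renyiH_spike hβ.ne' hmem hx0 ?_⟩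
  · filter_upwards [hx, eventually_gt_atTop 0] with m ⟨hm1, he⟩ hm
    exact ⟨hm1, by rw [renyiH_one_spike hm, he]⟩
  · have h2 := (tendsto_natCast_rpow_neg (b := β - 1) (by linarith)).mul
      (hx0.rpow_const (p := β) (Or.inr (by linarith)))
    simpa [zero_rpow (by linarith : β ≠ 0)] using h2

theorem renyi_trivial_lower_bound_tight
    (α₁ α₂ : ℝ) (hα₁ : 0 < α₁) (hα₁₂ : α₁ < α₂) (hα₁le : α₁ ≤ 1) :
    ∀ h > (0 : ℝ), ∀ ε > (0 : ℝ), ∃ n : ℕ, 2 ≤ n ∧ ∃ p : Fin n → ℝ,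
      (∀ i, 0 ≤ p i) ∧ ∑ i, p i = 1 ∧ renyiH α₁ p = h ∧ renyiH α₂ p < ε := by
  intro h hh ε hε
  obtain ⟨x, hx, hlim⟩ : ∃ x : ℕ → ℝ,
      (∀ᶠ m in atTop, x m ∈ Set.Icc (0 : ℝ) (1 / 2) ∧ renyiH α₁ (spike m (x m)) = h) ∧
      Tendsto (fun m => renyiH α₂ (spike m (x m))) atTop (nhds 0) := by
    rcases hα₁le.lt_or_eq with hlt | rfl
    · exact exists_spikes_of_lt_one hα₁ hlt hα₁₂ hh
    · exact exists_spikes_of_one hα₁₂ hh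
  obtain ⟨m, ⟨hxm, hH⟩, hm, hlt⟩ :=
    (hx.and ((eventually_gt_atTop 0).and (hlim.eventually_lt_const hε))).exists
  exact ⟨m + 1, by omega, spike m (x m), spike_nonneg hxm, sum_spike hm _, hH, hlt⟩
end

section
/- Let 0 < α_1 < α_2 < 1 and for n ≥ 2 set t_n = n^{1−1/α_2} (so that t_n ∈ (0,1) for n large). Then, along the sequence of probability vectors P_{n,t_n}, one has H_{α_2}(P_{n,t_n}) → (1/(1−α_2))·log 2 as n → ∞, while H_{α_1}(P_{n,t_n}) → ∞ as n → ∞. -/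
open Real Filter

/-- `Pnt n t` : the mixture `t·U_n + (1-t)·U_1`, the probability vector on `n` points
with the first `n-1` coordinates equal to `t/n` and last coordinate `t/n + 1 - t`. -/
noncomputable def Pnt (n : ℕ) (t : ℝ) : Fin n → ℝ :=
  fun i => if (i : ℕ) < n - 1 then t / n else t / n + 1 - t

theorem sum_Pnt_rpow (n : ℕ) (hn : n ≠ 0) (t α : ℝ) :
    ∑ i, Pnt n t i ^ α = ((n : ℝ) - 1) * (t / n) ^ α + (t / n + 1 - t) ^ α := by
  obtain ⟨m, rfl⟩ := Nat.exists_eq_succ_of_ne_zero hn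
  rw [Fin.sum_univ_castSucc]
  simp [Pnt]

theorem sum_Pnt_moving_parameter_rpow (n : ℕ) (hn : n ≠ 0) (α β : ℝ) :
    ∑ i, Pnt n ((n : ℝ) ^ (1 - 1 / β)) i ^ α =
      (n : ℝ) ^ (1 - α / β) - (n : ℝ) ^ (-(α / β)) +
        ((n : ℝ) ^ (-(1 / β)) + 1 - (n : ℝ) ^ (1 - 1 / β)) ^ α := by
  have hpos : (0 : ℝ) < n := by positivity
  have hdiv : (n : ℝ) ^ (1 - 1 / β) / n = (n : ℝ) ^ (-(1 / β)) := by
    rw [← rpow_sub_one hpos.ne']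
    ring_nf
  have hpow : ((n : ℝ) ^ (-(1 / β))) ^ α = (n : ℝ) ^ (-(α / β)) := by
    rw [← rpow_mul hpos.le]
    ring_nf
  have hmul : (n : ℝ) ^ (1 - α / β) = n * (n : ℝ) ^ (-(α / β)) := by
    rw [sub_eq_add_neg, rpow_add hpos, rpow_one]
  rw [sum_Pnt_rpow n hn, hdiv, hpow, hmul]
  ring

theorem tendsto_natCast_rpow_of_neg {c : ℝ} (hc : c < 0) :
    Tendsto (fun n : ℕ => (n : ℝ) ^ c) atTop (nhds 0) := by
  simpa [Function.comp_def] using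
    (tendsto_rpow_neg_atTop (neg_pos.2 hc)).comp tendsto_natCast_atTop_atTop

/-- The contribution of the heavy coordinate, together with the correction for the number of
light coordinates, tends to one. -/
theorem tendsto_heavy_coordinate_rpow {α β : ℝ} (hα : 0 < α) (hβ : 0 < β) (hβ₁ : β < 1) :
    Tendsto (fun n : ℕ => -(n : ℝ) ^ (-(α / β)) +
      ((n : ℝ) ^ (-(1 / β)) + 1 - (n : ℝ) ^ (1 - 1 / β)) ^ α) atTop (nhds 1) := by
  have hlight := tendsto_natCast_rpow_of_neg (neg_neg_of_pos (div_pos hα hβ))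
  have hmass := tendsto_natCast_rpow_of_neg (neg_neg_of_pos (one_div_pos.2 hβ))
  have ht := tendsto_natCast_rpow_of_neg (sub_neg.2 ((one_lt_div hβ).2 hβ₁))
  have hheavy := ((hmass.add_const 1).sub ht).rpow_const (p := α) (Or.inr hα.le)
  simpa using hlight.neg.add hheavy

theorem renyi_mixture_moving_parameter
    (α₁ α₂ : ℝ) (hα₁ : 0 < α₁) (hα₁₂ : α₁ < α₂) (hα₂ : α₂ < 1) :
    Filter.Tendsto
        (fun n : ℕ => renyiH α₂ (Pnt n ((n : ℝ) ^ (1 - 1 / α₂)))) Filter.atTop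
        (nhds ((1 / (1 - α₂)) * Real.log 2)) ∧
      Filter.Tendsto
        (fun n : ℕ => renyiH α₁ (Pnt n ((n : ℝ) ^ (1 - 1 / α₂)))) Filter.atTop
        Filter.atTop := by
  have hα₂_pos : 0 < α₂ := hα₁.trans hα₁₂
  have hα₁_lt : α₁ < 1 := hα₁₂.trans hα₂
  constructor
  · have hsum : Tendsto (fun n : ℕ => ∑ i, Pnt n ((n : ℝ) ^ (1 - 1 / α₂)) i ^ α₂) atTop
        (nhds 2) := by
      have h := (tendsto_heavy_coordinate_rpow hα₂_pos hα₂_pos hα₂).const_add 1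
      rw [one_add_one_eq_two] at h
      refine h.congr' ?_
      filter_upwards [eventually_ne_atTop 0] with n hn
      rw [sum_Pnt_moving_parameter_rpow n hn, div_self hα₂_pos.ne', sub_self, rpow_zero]
      ring
    simpa only [renyiH, if_neg hα₂.ne] using (hsum.log two_ne_zero).const_mul (1 / (1 - α₂))
  · have hsum : Tendsto (fun n : ℕ => ∑ i, Pnt n ((n : ℝ) ^ (1 - 1 / α₂)) i ^ α₁) atTop
        atTop := by
      have hexp : 0 < 1 - α₁ / α₂ := sub_pos.2 ((div_lt_one hα₂_pos).2 hα₁₂)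
      have h := ((tendsto_rpow_atTop hexp).comp tendsto_natCast_atTop_atTop).atTop_add
        (tendsto_heavy_coordinate_rpow hα₁ hα₂_pos hα₂)
      refine h.congr' ?_
      filter_upwards [eventually_ne_atTop 0] with n hn
      rw [sum_Pnt_moving_parameter_rpow n hn, Function.comp_apply]
      ring
    have hcoef : 0 < 1 / (1 - α₁) := one_div_pos.2 (sub_pos.2 hα₁_lt)
    simpa only [renyiH, if_neg hα₁_lt.ne, Function.comp_def] using
      (tendsto_log_atTop.comp hsum).const_mul_atTop hcoef
end

section
/- Let 0 < α_1 < α_2 be real numbers and let Q be any probability vector on n points, n ≥ 2. Then there exist an integer m with 2 ≤ m ≤ n and weights x, y, z ≥ 0 with x + y + z = 1 such that the probability vector P = x·U_m + y·U_{m−1} + z·U_1 satisfies H_{α_1}(P) = H_{α_1}(Q) and H_{α_2}(P) = H_{α_2}(Q). -/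
open Real Filter

/-- A normalised integrand for the Rényi entropy of order `α`, with second derivative
`t ^ (α - 2)` on `(0, ∞)`. -/
noncomputable def renyiKernel (α t : ℝ) : ℝ :=
  if α = 1 then t * Real.log t else t ^ α / (α * (α - 1))

/-- The sum of `renyiKernel α` over the coordinates of a vector. -/
noncomputable def renyiSum {n : ℕ} (α : ℝ) (p : Fin n → ℝ) : ℝ := ∑ i, renyiKernel α (p i)

theorem renyiH_eq_of_renyiSum_eq {n : ℕ} {α : ℝ} (hα : 0 < α) {p q : Fin n → ℝ}
    (h : renyiSum α p = renyiSum α q) : renyiH α p = renyiH α q := by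
  unfold renyiSum renyiKernel at h
  unfold renyiH
  split_ifs at h ⊢ with h1
  · rw [h]
  · rw [← Finset.sum_div, ← Finset.sum_div] at h
    have : α * (α - 1) ≠ 0 := mul_ne_zero hα.ne' (sub_ne_zero.2 h1)
    rw [(div_left_inj' this).1 h]

theorem continuous_renyiKernel {α : ℝ} (hα : 0 < α) : Continuous (renyiKernel α) := by
  unfold renyiKernel
  split_ifs
  · exact Real.continuous_mul_log
  · exact (Real.continuous_rpow_const hα.le).div_const _

theorem hasDerivAt_renyiKernel {α : ℝ} (hα : 0 < α) {t : ℝ} (ht : 0 < t) :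
    HasDerivAt (renyiKernel α)
      (if α = 1 then Real.log t + 1 else t ^ (α - 1) / (α - 1)) t := by
  unfold renyiKernel
  split_ifs with h1
  · exact Real.hasDerivAt_mul_log ht.ne'
  · have h2 : α - 1 ≠ 0 := sub_ne_zero.2 h1
    refine ((Real.hasDerivAt_rpow_const (p := α) (Or.inl ht.ne')).div_const
      (α * (α - 1))).congr_deriv ?_
    field_simp

theorem hasDerivAt_deriv_renyiKernel {α : ℝ} (hα : 0 < α) {t : ℝ} (ht : 0 < t) :
    HasDerivAt (deriv (renyiKernel α)) (t ^ (α - 2)) t := by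
  have h0 : deriv (renyiKernel α) =ᶠ[nhds t]
      fun t => if α = 1 then Real.log t + 1 else t ^ (α - 1) / (α - 1) := by
    filter_upwards [lt_mem_nhds ht] with s hs
    exact (hasDerivAt_renyiKernel hα hs).deriv
  refine HasDerivAt.congr_of_eventuallyEq ?_ h0
  split_ifs with h1
  · subst h1
    convert (Real.hasDerivAt_log ht.ne').add_const 1 using 1
    rw [show (1 : ℝ) - 2 = -1 by norm_num, Real.rpow_neg_one]
  · have h2 : α - 1 ≠ 0 := sub_ne_zero.2 h1
    refine ((Real.hasDerivAt_rpow_const (p := α - 1) (Or.inl ht.ne')).div_const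
      (α - 1)).congr_deriv ?_
    rw [show α - 1 - 1 = α - 2 by ring]
    field_simp

theorem deriv2_renyiKernel {α : ℝ} (hα : 0 < α) {t : ℝ} (ht : 0 < t) :
    deriv^[2] (renyiKernel α) t = t ^ (α - 2) :=
  (hasDerivAt_deriv_renyiKernel hα ht).deriv

theorem strictConvexOn_renyiKernel {α : ℝ} (hα : 0 < α) :
    StrictConvexOn ℝ (Set.Ici 0) (renyiKernel α) := by
  refine strictConvexOn_of_deriv2_pos (convex_Ici 0) (continuous_renyiKernel hα).continuousOn ?_
  intro x hx
  rw [interior_Ici, Set.mem_Ioi] at hx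
  rw [deriv2_renyiKernel hα hx]
  positivity

theorem deriv2_renyiKernel_sub {α β : ℝ} (hα : 0 < α) (hβ : 0 < β) (c : ℝ) {t : ℝ} (ht : 0 < t) :
    deriv^[2] (fun s => renyiKernel β s - c * renyiKernel α s) t
      = t ^ (α - 2) * (t ^ (β - α) - c) := by
  have h0 : deriv (fun s => renyiKernel β s - c * renyiKernel α s) =ᶠ[nhds t]
      fun s => deriv (renyiKernel β) s - c * deriv (renyiKernel α) s := by
    filter_upwards [lt_mem_nhds ht] with s hs
    exact ((hasDerivAt_renyiKernel hβ hs).differentiableAt.hasDerivAt.sub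
      ((hasDerivAt_renyiKernel hα hs).differentiableAt.hasDerivAt.const_mul c)).deriv
  have h1 : t ^ (β - 2) = t ^ (α - 2) * t ^ (β - α) := by
    rw [← Real.rpow_add ht]
    ring_nf
  have h2 := (((hasDerivAt_deriv_renyiKernel hβ ht).sub
    ((hasDerivAt_deriv_renyiKernel hα ht).const_mul c)).congr_of_eventuallyEq h0).deriv
  rw [Function.iterate_succ, Function.iterate_one, Function.comp_apply, h2, h1]
  ring

theorem StrictConvexOn.add_lt_add_of_add_eq {s : Set ℝ} {f : ℝ → ℝ} (hf : StrictConvexOn ℝ s f)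
    {a b c d : ℝ} (ha : a ∈ s) (hb : b ∈ s) (hsum : a + b = c + d) (hac : a < c) (hcb : c < b) :
    f c + f d < f a + f b := by
  have hab : 0 < b - a := by linarith
  have hne : b - a ≠ 0 := hab.ne'
  have hu : 0 < (b - c) / (b - a) := div_pos (by linarith) hab
  have hv : 0 < (c - a) / (b - a) := div_pos (by linarith) hab
  have huv : (b - c) / (b - a) + (c - a) / (b - a) = 1 := by field_simp; ring
  have h1 := hf.2 ha hb (by linarith) hu hv huv
  have h2 := hf.2 ha hb (by linarith) hv hu (by linarith)
  have e1 : (b - c) / (b - a) * a + (c - a) / (b - a) * b = c := by field_simp; ring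
  have e2 : (c - a) / (b - a) * a + (b - c) / (b - a) * b = d := by
    rw [show d = a + b - c by linarith]; field_simp; ring
  simp only [smul_eq_mul] at h1 h2
  rw [e1] at h1
  rw [e2] at h2
  linear_combination h1 + h2 + (f a + f b) * huv

/-- Spreading `x, y` (above `t`) and contracting `t, z` (below `t`) so that the `α`-sum is preserved
increases the `β`-sum when `α < β`. -/
theorem renyiKernel_add_lt_of_spread_contract {α β : ℝ} (hα : 0 < α) (hαβ : α < β)
    {x y z x' y' z' t : ℝ} (hz : 0 ≤ z) (htop : x + y = x' + t) (hbot : t + z = y' + z')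
    (hty : t < y) (hyx : y < x') (hzz : z < z') (hzt : z' < t)
    (hf : renyiKernel α x' + renyiKernel α y' + renyiKernel α z'
      = renyiKernel α x + renyiKernel α y + renyiKernel α z) :
    renyiKernel β x + renyiKernel β y + renyiKernel β z
      < renyiKernel β x' + renyiKernel β y' + renyiKernel β z' := by
  have hβ : 0 < β := hα.trans hαβ
  have ht : 0 < t := by linarith
  have hcont : Continuous fun s => renyiKernel β s - t ^ (β - α) * renyiKernel α s :=
    (continuous_renyiKernel hβ).sub (continuous_const.mul (continuous_renyiKernel hα))
  have hvex : StrictConvexOn ℝ (Set.Ici t)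
      fun s => renyiKernel β s - t ^ (β - α) * renyiKernel α s := by
    refine strictConvexOn_of_deriv2_pos (convex_Ici t) hcont.continuousOn fun s hs => ?_
    rw [interior_Ici, Set.mem_Ioi] at hs
    have hs0 : 0 < s := ht.trans hs
    rw [deriv2_renyiKernel_sub hα hβ _ hs0]
    have := Real.rpow_lt_rpow ht.le hs (sub_pos.2 hαβ)
    exact mul_pos (Real.rpow_pos_of_pos hs0 _) (by linarith)
  have hcave : StrictConcaveOn ℝ (Set.Icc 0 t)
      fun s => renyiKernel β s - t ^ (β - α) * renyiKernel α s := by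
    refine strictConcaveOn_of_deriv2_neg (convex_Icc 0 t) hcont.continuousOn fun s hs => ?_
    rw [interior_Icc, Set.mem_Ioo] at hs
    rw [deriv2_renyiKernel_sub hα hβ _ hs.1]
    have := Real.rpow_lt_rpow hs.1.le hs.2 (sub_pos.2 hαβ)
    exact mul_neg_of_pos_of_neg (Real.rpow_pos_of_pos hs.1 _) (by linarith)
  have h1 := hvex.add_lt_add_of_add_eq (a := t) (b := x') (c := y) (d := x)
    (Set.mem_Ici.2 le_rfl) (Set.mem_Ici.2 (by linarith)) (by linarith) hty hyx
  have h2 := hcave.neg.add_lt_add_of_add_eq (a := z) (b := t) (c := z') (d := y')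
    ⟨hz, by linarith⟩ ⟨ht.le, le_rfl⟩ (by linarith) hzz hzt
  simp only [Pi.neg_apply] at h2
  linear_combination h1 + h2 - t ^ (β - α) * hf

/-- Three coordinates `x ≥ y > z` can be modified to increase the `β`-sum, keeping the sum and the
`α`-sum. -/
theorem exists_renyiKernel_add_gt {α β : ℝ} (hα : 0 < α) (hαβ : α < β) {x y z : ℝ}
    (hxy : y ≤ x) (hyz : z < y) (hz : 0 ≤ z) :
    ∃ x' y' z' : ℝ, 0 ≤ x' ∧ 0 ≤ y' ∧ 0 ≤ z' ∧ x' + y' + z' = x + y + z ∧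
      renyiKernel α x' + renyiKernel α y' + renyiKernel α z'
        = renyiKernel α x + renyiKernel α y + renyiKernel α z ∧
      renyiKernel β x + renyiKernel β y + renyiKernel β z
        < renyiKernel β x' + renyiKernel β y' + renyiKernel β z' := by
  obtain ⟨d, hd⟩ : ∃ d, d = (y - z) / 2 := ⟨_, rfl⟩
  have hd0 : 0 < d := by linarith
  have hconv := strictConvexOn_renyiKernel hα
  have hcont := continuous_renyiKernel hα
  have h0 := hconv.add_lt_add_of_add_eq (a := z) (b := y) (c := z + d) (d := z + d)
    (Set.mem_Ici.2 hz) (Set.mem_Ici.2 (by linarith)) (by linarith) (by linarith) (by linarith)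
  have h1 := hconv.add_lt_add_of_add_eq (a := z + d) (b := x + d) (c := y) (d := x)
    (Set.mem_Ici.2 (by linarith)) (Set.mem_Ici.2 (by linarith)) (by linarith) (by linarith)
    (by linarith)
  obtain ⟨u, ⟨hu0, hud⟩, hu⟩ := intermediate_value_Ioo hd0.le
    (f := fun u => renyiKernel α (x + u) + renyiKernel α (z + d) + renyiKernel α (z + d - u))
    (by fun_prop)
    (show renyiKernel α x + renyiKernel α y + renyiKernel α z ∈ _ by
      simp only [Set.mem_Ioo, add_zero, sub_zero, add_sub_cancel_right]
      constructor <;> linarith)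
  exact ⟨x + u, z + d, z + d - u, by linarith, by linarith, by linarith, by linarith, hu,
    renyiKernel_add_lt_of_spread_contract hα hαβ (t := y - u) hz (by ring) (by linarith)
      (by linarith) (by linarith) (by linarith) (by linarith) hu⟩

/-- Three coordinates `x > y ≥ z > 0` can be modified to decrease the `β`-sum, keeping the sum and
the `α`-sum. -/
theorem exists_renyiKernel_add_lt {α β : ℝ} (hα : 0 < α) (hαβ : α < β) {x y z : ℝ}
    (hxy : y < x) (hyz : z ≤ y) (hz : 0 < z) :
    ∃ x' y' z' : ℝ, 0 ≤ x' ∧ 0 ≤ y' ∧ 0 ≤ z' ∧ x' + y' + z' = x + y + z ∧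
      renyiKernel α x' + renyiKernel α y' + renyiKernel α z'
        = renyiKernel α x + renyiKernel α y + renyiKernel α z ∧
      renyiKernel β x' + renyiKernel β y' + renyiKernel β z'
        < renyiKernel β x + renyiKernel β y + renyiKernel β z := by
  obtain ⟨d, hd⟩ : ∃ d, d = min ((x - y) / 2) z := ⟨_, rfl⟩
  have hd0 : 0 < d := by rw [hd]; exact lt_min (by linarith) hz
  have hd1 : d ≤ (x - y) / 2 := hd.trans_le (min_le_left _ _)
  have hd2 : d ≤ z := hd.trans_le (min_le_right _ _)
  have hconv := strictConvexOn_renyiKernel hα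
  have hcont := continuous_renyiKernel hα
  have h0 := hconv.add_lt_add_of_add_eq (a := y) (b := x) (c := y + d) (d := x - d)
    (Set.mem_Ici.2 (by linarith)) (Set.mem_Ici.2 (by linarith)) (by linarith) (by linarith)
    (by linarith)
  have h1 := hconv.add_lt_add_of_add_eq (a := z - d) (b := y + d) (c := z) (d := y)
    (Set.mem_Ici.2 (by linarith)) (Set.mem_Ici.2 (by linarith)) (by linarith) (by linarith)
    (by linarith)
  obtain ⟨u, ⟨hu0, hud⟩, hu⟩ := intermediate_value_Ioo hd0.le
    (f := fun u => renyiKernel α (x - d + u) + renyiKernel α (y + d) + renyiKernel α (z - u))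
    (by fun_prop)
    (show renyiKernel α x + renyiKernel α y + renyiKernel α z ∈ _ by
      simp only [Set.mem_Ioo, add_zero, sub_zero, sub_add_cancel]
      constructor <;> linarith)
  refine ⟨x - d + u, y + d, z - u, by linarith, by linarith, by linarith, by linarith, hu, ?_⟩
  have := renyiKernel_add_lt_of_spread_contract hα hαβ (t := y + u) (x := x - d + u) (y := y + d)
    (z := z - u) (x' := x) (y' := y) (z' := z) (by linarith) (by ring) (by ring)
    (by linarith) (by linarith) (by linarith) (by linarith) hu.symm
  exact this

/-- If `p` and `q` have the same sum and every coordinate where `q` does not attain its maximum `B`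
is smaller in `p`, then `p` is at least as concentrated as `q`. -/
theorem renyiSum_le_of_concentrated {n : ℕ} {α : ℝ} (hα : 0 < α) {p q : Fin n → ℝ} {B : ℝ}
    (hB : 0 < B) (hp : ∀ i, 0 ≤ p i) (hsum : ∑ i, p i = ∑ i, q i)
    (h : ∀ i, q i = B ∨ (p i ≤ q i ∧ q i ≤ B)) : renyiSum α q ≤ renyiSum α p := by
  obtain ⟨c, hc⟩ : ∃ c, HasDerivAt (renyiKernel α) c B := ⟨_, hasDerivAt_renyiKernel hα hB⟩
  have hconv := (strictConvexOn_renyiKernel hα).convexOn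
  have hmin : ∀ r, 0 ≤ r → renyiKernel α B - c * B ≤ renyiKernel α r - c * r := by
    intro r hr
    rcases lt_trichotomy r B with hrB | rfl | hrB
    · have h1 := hconv.slope_le_of_hasDerivAt (Set.mem_Ici.2 hr) (Set.mem_Ici.2 hB.le) hrB hc
      rw [slope_def_field, div_le_iff₀ (by linarith)] at h1
      linarith
    · rfl
    · have h1 := hconv.le_slope_of_hasDerivAt (Set.mem_Ici.2 hB.le) (Set.mem_Ici.2 hr) hrB hc
      rw [slope_def_field, le_div_iff₀ (by linarith)] at h1
      linarith
  have hψ : ConvexOn ℝ (Set.Ici 0) fun r => renyiKernel α r - c * r := by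
    refine hconv.sub ⟨convex_Ici 0, fun x _ y _ a b _ _ _ => ?_⟩
    simp only [smul_eq_mul]
    exact le_of_eq (by ring)
  have key : ∀ i, renyiKernel α (q i) - c * q i ≤ renyiKernel α (p i) - c * p i := by
    intro i
    rcases h i with h1 | ⟨h1, h2⟩
    · rw [h1]
      exact hmin _ (hp i)
    · have h3 := hψ.le_max_of_mem_Icc (Set.mem_Ici.2 (hp i)) (Set.mem_Ici.2 hB.le) ⟨h1, h2⟩
      rwa [max_eq_left (hmin _ (hp i))] at h3
  have h4 := Finset.sum_le_sum fun i (_ : i ∈ Finset.univ) => key i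
  simp only [Finset.sum_sub_distrib, ← Finset.mul_sum, hsum] at h4
  unfold renyiSum
  linarith

/-- The `i`-th coordinate of the probability vector `(b, …, b, c, 0, …, 0)` with `c ≤ b`. -/
noncomputable def flatCoord (b : ℝ) (i : ℕ) : ℝ := min 1 ((i + 1) * b) - min 1 (i * b)

/-- The mixture of `(b, …, b, c, 0, …, 0)` with weight `1 - s` and of `(1, 0, …, 0)` with
weight `s`. -/
noncomputable def flatMix (n : ℕ) (b s : ℝ) : Fin n → ℝ :=
  fun i => (1 - s) * flatCoord b i + s * (if (i : ℕ) = 0 then 1 else 0)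

theorem flatCoord_nonneg {b : ℝ} (hb : 0 ≤ b) (i : ℕ) : 0 ≤ flatCoord b i :=
  sub_nonneg.2 (min_le_min le_rfl (by nlinarith))

theorem flatCoord_of_le {b : ℝ} (hb : 0 ≤ b) {i : ℕ} (h : (i + 1) * b ≤ 1) :
    flatCoord b i = b := by
  unfold flatCoord
  rw [min_eq_right h, min_eq_right (by linarith)]
  ring

theorem flatCoord_of_ge {b : ℝ} {i : ℕ} (h : 1 ≤ (i + 1) * b) :
    flatCoord b i = 1 - min 1 (i * b) := by
  unfold flatCoord
  rw [min_eq_left h]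

theorem flatCoord_le {b : ℝ} (hb : 0 ≤ b) (i : ℕ) : flatCoord b i ≤ b := by
  rcases le_total ((i + 1) * b) 1 with h | h
  · exact (flatCoord_of_le hb h).le
  · rw [flatCoord_of_ge h]
    rcases min_cases 1 ((i : ℝ) * b) with h1 | h1 <;> linarith

theorem sum_flatCoord {n : ℕ} {b : ℝ} (h : 1 ≤ n * b) : ∑ i : Fin n, flatCoord b i = 1 := by
  rw [Fin.sum_univ_eq_sum_range (fun i => flatCoord b i)]
  have := Finset.sum_range_sub (fun i : ℕ => min 1 ((i : ℝ) * b)) n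
  simp only [Nat.cast_add, Nat.cast_one] at this
  unfold flatCoord
  rw [this]
  simp [h]

theorem sum_flatMix {n : ℕ} {b s : ℝ} (h : 1 ≤ n * b) : ∑ i, flatMix n b s i = 1 := by
  have hn : 0 < n := by
    rcases Nat.eq_zero_or_pos n with rfl | hn
    · norm_num at h
    · exact hn
  have h1 : ∑ i : Fin n, (if (i : ℕ) = 0 then (1 : ℝ) else 0) = 1 := by
    rw [Finset.sum_eq_single (⟨0, hn⟩ : Fin n)]
    · simp
    · intro i _ hi
      rw [if_neg fun h0 => hi (Fin.ext h0)]
    · simp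
  simp only [flatMix, Finset.sum_add_distrib, ← Finset.mul_sum, sum_flatCoord h, h1]
  ring

theorem flatMix_nonneg {n : ℕ} {b s : ℝ} (hb : 0 ≤ b) (hs : s ∈ Set.Icc (0 : ℝ) 1) (i : Fin n) :
    0 ≤ flatMix n b s i := by
  have := flatCoord_nonneg hb i
  have h1 := hs.1
  have h2 : 0 ≤ 1 - s := sub_nonneg.2 hs.2
  unfold flatMix
  positivity

theorem continuous_renyiSum_flatMix {α : ℝ} (hα : 0 < α) (n : ℕ) :
    Continuous fun x : ℝ × ℝ => renyiSum α (flatMix n x.1 x.2) := by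
  have := continuous_renyiKernel hα
  unfold renyiSum flatMix flatCoord
  fun_prop

theorem renyiSum_flatMix_zero_mono {n : ℕ} {α b b' : ℝ} (hα : 0 < α) (hb : 0 < b) (hbb : b ≤ b')
    (h : 1 ≤ n * b) : renyiSum α (flatMix n b 0) ≤ renyiSum α (flatMix n b' 0) := by
  have h' : 1 ≤ n * b' := h.trans (by gcongr)
  refine renyiSum_le_of_concentrated hα hb (flatMix_nonneg (hb.le.trans hbb) (by simp))
    (by rw [sum_flatMix h, sum_flatMix h']) fun i => ?_
  simp only [flatMix, sub_zero, one_mul, zero_mul, add_zero]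
  rcases le_total (((i : ℕ) + 1) * b) 1 with h1 | h1
  · exact Or.inl (flatCoord_of_le hb.le h1)
  · refine Or.inr ⟨?_, flatCoord_le hb.le _⟩
    rw [flatCoord_of_ge h1, flatCoord_of_ge (h1.trans (by gcongr))]
    gcongr

theorem renyiSum_flatMix_mono {n : ℕ} {α b : ℝ} (hα : 0 < α) (hb : 0 < b) (hb1 : b ≤ 1)
    (h : 1 ≤ n * b) :
    MonotoneOn (fun s => renyiSum α (flatMix n b s)) (Set.Icc 0 1) := by
  intro s hs s' hs' hss
  have hB : b ≤ (1 - s) * b + s := by nlinarith [mul_nonneg hs.1 (sub_nonneg.2 hb1)]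
  refine renyiSum_le_of_concentrated hα (hb.trans_le hB) (flatMix_nonneg hb.le hs')
    (by rw [sum_flatMix h, sum_flatMix h]) fun i => ?_
  by_cases hi : (i : ℕ) = 0
  · left
    simp only [flatMix, hi, if_true, mul_one]
    rw [flatCoord_of_le hb.le (by simpa using hb1)]
  · right
    simp only [flatMix, hi, if_false, mul_zero, add_zero]
    have h0 := flatCoord_nonneg hb.le i
    have h1 := flatCoord_le hb.le i
    have h2 : 0 ≤ 1 - s := sub_nonneg.2 hs.2
    constructor
    · gcongr
    · have := hs.1
      nlinarith

theorem flatMix_one {n : ℕ} (b b' : ℝ) : flatMix n b 1 = flatMix n b' 1 := by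
  funext i
  simp [flatMix]

theorem exists_flatMix_eq_unif {n : ℕ} (hn : 2 ≤ n) {b s : ℝ} (hb : 0 < b) (hb1 : b ≤ 1)
    (hnb : 1 ≤ n * b) (hs : s ∈ Set.Icc (0 : ℝ) 1) :
    ∃ m : ℕ, 2 ≤ m ∧ m ≤ n ∧ ∃ x y z : ℝ, 0 ≤ x ∧ 0 ≤ y ∧ 0 ≤ z ∧ x + y + z = 1 ∧
      (fun i => x * unif n m i + y * unif n (m - 1) i + z * unif n 1 i) = flatMix n b s := by
  classical
  have hex : ∃ m : ℕ, 2 ≤ m ∧ 1 ≤ m * b := ⟨n, hn, hnb⟩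
  obtain ⟨k, hk1, hkn, hkb, hkb'⟩ :
      ∃ k : ℕ, 1 ≤ k ∧ k + 1 ≤ n ∧ k * b ≤ 1 ∧ 1 ≤ (k + 1) * b := by
    obtain ⟨hm2, hmb⟩ := Nat.find_spec hex
    have hmn : Nat.find hex ≤ n := Nat.find_min' hex ⟨hn, hnb⟩
    obtain ⟨k, hk⟩ : ∃ k, Nat.find hex = k + 1 := ⟨Nat.find hex - 1, by omega⟩
    rw [hk] at hm2 hmb hmn
    refine ⟨k, by omega, hmn, ?_, by exact_mod_cast hmb⟩
    by_contra! hcon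
    have hk2 : 2 ≤ k := by
      by_contra! hk2
      have : k = 1 := by omega
      subst this
      norm_num at hcon
      linarith
    have := Nat.find_min' hex (m := k) ⟨hk2, hcon.le⟩
    omega
  have hk0 : (0 : ℝ) < k := by exact_mod_cast hk1
  have hs1 : 0 ≤ 1 - s := sub_nonneg.2 hs.2
  have hx : 0 ≤ 1 - k * b := sub_nonneg.2 hkb
  have hy : 0 ≤ (k + 1) * b - 1 := sub_nonneg.2 hkb'
  refine ⟨k + 1, by omega, hkn, (1 - s) * ((k + 1) * (1 - k * b)),
    (1 - s) * (k * ((k + 1) * b - 1)), s, by positivity, by positivity, hs.1, by ring, ?_⟩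
  funext i
  have h1 : (if (i : ℕ) < 1 then ((1 : ℕ) : ℝ)⁻¹ else 0) = if (i : ℕ) = 0 then 1 else 0 := by
    simp
  simp only [unif, flatMix, h1, Nat.add_sub_cancel]
  congr 1
  have hk1' : ((k + 1 : ℕ) : ℝ) ≠ 0 := by positivity
  rcases lt_trichotomy (i : ℕ) k with hik | hik | hik
  · rw [if_pos (by omega), if_pos hik, flatCoord_of_le hb.le]
    · push_cast at hk1' ⊢
      field_simp
      ring
    · have : ((i : ℕ) : ℝ) + 1 ≤ k := by exact_mod_cast hik
      nlinarith
  · rw [if_pos (by omega), if_neg (by omega), hik, flatCoord_of_ge hkb', min_eq_right hkb]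
    push_cast at hk1' ⊢
    field_simp
    ring
  · have : (k : ℝ) + 1 ≤ (i : ℕ) := by exact_mod_cast hik
    have h2 : 1 ≤ ((i : ℕ) : ℝ) * b := hkb'.trans (by gcongr)
    rw [if_neg (by omega), if_neg (by omega), flatCoord_of_ge (by linarith), min_eq_left h2]
    ring

/-- An antitone probability vector whose coordinates after the first one are equal is a mixture of
the uniform distribution and a point mass. -/
theorem exists_eq_flatMix_inv {n : ℕ} (hn : 2 ≤ n) {p : Fin n → ℝ} (hp : Antitone p)
    (hp0 : ∀ i, 0 ≤ p i) (hsum : ∑ i, p i = 1) (h : ∀ i j k, i < j → j < k → p j = p k) :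
    ∃ s ∈ Set.Icc (0 : ℝ) 1, p = flatMix n (n : ℝ)⁻¹ s := by
  obtain ⟨n, rfl⟩ : ∃ k, n = k + 2 := ⟨n - 2, by omega⟩
  have hc : ∀ i : Fin (n + 1), p i.succ = p 1 := by
    intro i
    rcases Fin.eq_zero_or_eq_succ i with rfl | ⟨j, rfl⟩
    · rfl
    · refine (h 0 1 _ (by simp) ?_).symm
      rw [Fin.lt_def]
      simp
  rw [Fin.sum_univ_succ] at hsum
  simp only [hc, Finset.sum_const, Finset.card_univ, Fintype.card_fin, nsmul_eq_mul] at hsum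
  have h1 := hp0 1
  have h01 : p 1 ≤ p 0 := hp (Fin.zero_le 1)
  push_cast at hsum
  have hn0 : ((n + 2 : ℕ) : ℝ) ≠ 0 := by positivity
  have hinv : ((n + 2 : ℕ) : ℝ) * ((n + 2 : ℕ) : ℝ)⁻¹ = 1 := mul_inv_cancel₀ hn0
  have hcoord : ∀ i : Fin (n + 2), flatCoord (((n + 2 : ℕ) : ℝ)⁻¹) i = ((n + 2 : ℕ) : ℝ)⁻¹ := by
    intro i
    refine flatCoord_of_le (by positivity) ?_
    have : ((i : ℕ) : ℝ) + 1 ≤ ((n + 2 : ℕ) : ℝ) := by exact_mod_cast i.2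
    calc (((i : ℕ) : ℝ) + 1) * ((n + 2 : ℕ) : ℝ)⁻¹
        ≤ ((n + 2 : ℕ) : ℝ) * ((n + 2 : ℕ) : ℝ)⁻¹ := by gcongr
      _ = 1 := hinv
  have hn1 : (0 : ℝ) ≤ n := Nat.cast_nonneg n
  refine ⟨1 - ((n + 2 : ℕ) : ℝ) * p 1, ⟨by push_cast; nlinarith, ?_⟩, ?_⟩
  · have : 0 ≤ ((n + 2 : ℕ) : ℝ) * p 1 := by positivity
    linarith
  · funext i
    simp only [flatMix, hcoord]
    rcases Fin.eq_zero_or_eq_succ i with rfl | ⟨j, rfl⟩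
    · simp only [Fin.val_zero, if_true]
      have : p 0 = 1 - (n + 1) * p 1 := by linarith
      rw [this]
      push_cast at hn0 ⊢
      field_simp
      ring
    · rw [hc, if_neg (by simp)]
      linear_combination (-p 1) * hinv

/-- An antitone probability vector of the form `(b, …, b, c, 0, …, 0)` is determined by `b`. -/
theorem exists_eq_flatMix_zero {n : ℕ} (hn : 2 ≤ n) {p : Fin n → ℝ} (hp : Antitone p)
    (hp0 : ∀ i, 0 ≤ p i) (hsum : ∑ i, p i = 1)
    (h : ∀ i j k, i < j → j < k → p i = p j ∨ p k = 0) :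
    ∃ b, (n : ℝ)⁻¹ ≤ b ∧ b ≤ 1 ∧ p = flatMix n b 0 := by
  obtain ⟨n, rfl⟩ : ∃ k, n = k + 1 := ⟨n - 1, by omega⟩
  have hle : ∀ i, p i ≤ p 0 := fun i => hp (Fin.zero_le i)
  have hpartial : ∀ t : Finset (Fin (n + 1)), ∑ i ∈ t, p i ≤ 1 := fun t =>
    (Finset.sum_le_sum_of_subset_of_nonneg (Finset.subset_univ t) fun i _ _ => hp0 i).trans
      hsum.le
  have hbound : ∀ t : Finset (Fin (n + 1)), ∑ i ∈ t, p i ≤ t.card * p 0 := fun t =>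
    (Finset.sum_le_card_nsmul t p (p 0) fun i _ => hle i).trans (by rw [nsmul_eq_mul])
  have hiio : ∀ i : Fin (n + 1), ∑ j ∈ Finset.Iio i, p j = min 1 ((i : ℕ) * p 0) := by
    intro i
    by_cases hall : ∀ j < i, p j = p 0
    · have h1 : ∑ j ∈ Finset.Iio i, p j = (i : ℕ) * p 0 := by
        rw [Finset.sum_congr rfl fun j hj => hall j (Finset.mem_Iio.1 hj)]
        simp
      rw [← h1, min_eq_right (hpartial _)]
    · push Not at hall
      obtain ⟨j, hji, hj⟩ := hall
      have hj0 : 0 < j := Fin.pos_iff_ne_zero.2 fun h0 => hj (by rw [h0])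
      have h1 : ∑ j ∈ Finset.Iio i, p j = 1 := by
        rw [← hsum]
        refine Finset.sum_subset (Finset.subset_univ _) fun k _ hk => ?_
        rw [Finset.mem_Iio, not_lt] at hk
        exact (h 0 j k hj0 (hji.trans_le hk)).resolve_left (Ne.symm hj)
      have h2 := hbound (Finset.Iio i)
      rw [Fin.card_Iio, h1] at h2
      rw [h1, min_eq_left h2]
  have hiic : ∀ i : Fin (n + 1), ∑ j ∈ Finset.Iic i, p j = min 1 (((i : ℕ) + 1) * p 0) := by
    intro i
    by_cases hi : i = Fin.last n
    · have h1 : Finset.Iic i = Finset.univ := by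
        ext j; simp [hi, Fin.le_last]
      have h2 := hbound Finset.univ
      rw [hsum, Finset.card_univ, Fintype.card_fin] at h2
      rw [h1, hsum, hi, Fin.val_last, min_eq_left (by exact_mod_cast h2)]
    · have hlt : (i : ℕ) + 1 < n + 1 := by
        have := Fin.val_lt_last hi
        omega
      have h1 : Finset.Iic i = Finset.Iio ⟨(i : ℕ) + 1, hlt⟩ := by
        ext j
        simp only [Finset.mem_Iic, Finset.mem_Iio, Fin.le_def, Fin.lt_def]
        omega
      rw [h1, hiio]
      push_cast
      rfl
  have h1 := hbound Finset.univ
  rw [hsum, Finset.card_univ, Fintype.card_fin] at h1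
  refine ⟨p 0, ?_, by simpa using hpartial {0}, ?_⟩
  · rw [inv_le_iff_one_le_mul₀ (by positivity)]
    linarith
  · funext i
    have h2 : ∑ j ∈ Finset.Iic i, p j = p i + ∑ j ∈ Finset.Iio i, p j := by
      rw [← Finset.Iio_insert, Finset.sum_insert (by simp)]
    simp only [flatMix, flatCoord, ← hiio, ← hiic, h2]
    ring

/-- Probability vectors with prescribed `renyiSum α`. -/
def renyiLevel (n : ℕ) (α c : ℝ) : Set (Fin n → ℝ) := {p ∈ stdSimplex ℝ (Fin n) | renyiSum α p = c}

theorem continuous_renyiSum {n : ℕ} {α : ℝ} (hα : 0 < α) :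
    Continuous (renyiSum α : (Fin n → ℝ) → ℝ) := by
  have := continuous_renyiKernel hα
  unfold renyiSum
  fun_prop

theorem isCompact_renyiLevel {n : ℕ} {α : ℝ} (hα : 0 < α) (c : ℝ) :
    IsCompact (renyiLevel n α c) :=
  (isCompact_stdSimplex ℝ (Fin n)).inter_right
    (isClosed_eq (continuous_renyiSum hα) continuous_const)

theorem renyiSum_comp_perm {n : ℕ} (α : ℝ) (p : Fin n → ℝ) (σ : Equiv.Perm (Fin n)) :
    renyiSum α (p ∘ σ) = renyiSum α p :=
  Equiv.sum_comp σ fun i => renyiKernel α (p i)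

theorem exists_antitone_mem_renyiLevel {n : ℕ} {α c : ℝ} {p : Fin n → ℝ}
    (hp : p ∈ renyiLevel n α c) :
    ∃ q ∈ renyiLevel n α c, Antitone q ∧ ∀ β, renyiSum β q = renyiSum β p := by
  obtain ⟨⟨h0, h1⟩, h2⟩ := hp
  let σ := Tuple.sort fun i => -p i
  refine ⟨p ∘ σ, ⟨⟨fun i => h0 _, ?_⟩, ?_⟩, fun i j hij => ?_, fun β => renyiSum_comp_perm β p σ⟩
  · rw [← h1]
    exact Equiv.sum_comp σ p
  · rw [renyiSum_comp_perm, h2]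
  · exact neg_le_neg_iff.1 (Tuple.monotone_sort (fun i => -p i) hij)

theorem exists_sum_replace_three {n : ℕ} (p : Fin n → ℝ) {i j k : Fin n} (hij : i < j)
    (hjk : j < k) (x y z : ℝ) :
    ∃ q : Fin n → ℝ, (∀ l, q l = x ∨ q l = y ∨ q l = z ∨ q l = p l) ∧
      ∀ f : ℝ → ℝ, ∑ l, f (q l) - ∑ l, f (p l)
        = (f x + f y + f z) - (f (p i) + f (p j) + f (p k)) := by
  have hij' := hij.ne
  have hjk' := hjk.ne
  have hik' := (hij.trans hjk).ne
  refine ⟨fun l => if l = i then x else if l = j then y else if l = k then z else p l,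
    fun l => ?_, fun f => ?_⟩
  · dsimp only
    split_ifs <;> simp
  · rw [← Finset.sum_sub_distrib, ← Finset.sum_subset (Finset.subset_univ {i, j, k})]
    · rw [Finset.sum_insert (by simp [hij', hik']), Finset.sum_insert (by simp [hjk']),
        Finset.sum_singleton]
      simp only [if_true, hij'.symm, hik'.symm, hjk'.symm, if_false]
      ring
    · intro l _ hl
      simp only [Finset.mem_insert, Finset.mem_singleton, not_or] at hl
      simp [hl]

theorem exists_mem_renyiLevel_replace_three {n : ℕ} {α β c : ℝ} {p : Fin n → ℝ}
    (hp : p ∈ renyiLevel n α c) {i j k : Fin n} (hij : i < j) (hjk : j < k) {x y z : ℝ}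
    (hx : 0 ≤ x) (hy : 0 ≤ y) (hz : 0 ≤ z) (hsum : x + y + z = p i + p j + p k)
    (hα : renyiKernel α x + renyiKernel α y + renyiKernel α z
      = renyiKernel α (p i) + renyiKernel α (p j) + renyiKernel α (p k)) :
    ∃ q ∈ renyiLevel n α c, renyiSum β q - renyiSum β p
      = (renyiKernel β x + renyiKernel β y + renyiKernel β z)
        - (renyiKernel β (p i) + renyiKernel β (p j) + renyiKernel β (p k)) := by
  obtain ⟨⟨h0, h1⟩, h2⟩ := hp
  obtain ⟨q, hq, hqf⟩ := exists_sum_replace_three p hij hjk x y z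
  refine ⟨q, ⟨⟨fun l => ?_, ?_⟩, ?_⟩, hqf (renyiKernel β)⟩
  · have := h0 l
    rcases hq l with h | h | h | h <;> rw [h] <;> assumption
  · have := hqf id
    simp only [id_eq] at this
    linarith
  · have : renyiSum α q - renyiSum α p = _ := hqf (renyiKernel α)
    linarith

theorem isPreconnected_of_preconnected_fibers {Z : Set (ℝ × ℝ)} {a b : ℝ} (hZ : IsCompact Z)
    (himage : Prod.fst '' Z = Set.Icc a b)
    (hfiber : ∀ r ∈ Set.Icc a b, IsPreconnected {s | (r, s) ∈ Z}) : IsPreconnected Z := by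
  rw [isPreconnected_closed_iff]
  rintro A B hA hB hAB ⟨u, huZ, huA⟩ ⟨v, hvZ, hvB⟩
  have hmem : ∀ w ∈ Z, w.1 ∈ Set.Icc a b := fun w hw => himage ▸ Set.mem_image_of_mem _ hw
  obtain ⟨r, hr, ⟨w, ⟨hwZ, hwA⟩, hwr⟩, ⟨w', ⟨hwZ', hwB⟩, hwr'⟩⟩ :=
    isPreconnected_closed_iff.1 (isPreconnected_Icc (a := a) (b := b))
      (Prod.fst '' (Z ∩ A)) (Prod.fst '' (Z ∩ B))
      ((hZ.inter_right hA).image continuous_fst).isClosed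
      ((hZ.inter_right hB).image continuous_fst).isClosed
      (by
        rw [← Set.image_union, ← Set.inter_union_distrib_left, ← himage,
          Set.inter_eq_left.2 hAB])
      ⟨u.1, hmem u huZ, u, ⟨huZ, huA⟩, rfl⟩ ⟨v.1, hmem v hvZ, v, ⟨hvZ, hvB⟩, rfl⟩
  obtain ⟨w1, w2⟩ := w
  obtain ⟨w1', w2'⟩ := w'
  dsimp only at hwr hwr'
  subst hwr hwr'
  have hcont : Continuous fun s : ℝ => (w1', s) := by fun_prop
  obtain ⟨s, hs, hsA, hsB⟩ := isPreconnected_closed_iff.1 (hfiber _ hr) _ _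
    (hA.preimage hcont) (hB.preimage hcont) (fun s hs => hAB hs) ⟨w2, hwZ, hwA⟩ ⟨w2', hwZ', hwB⟩
  exact ⟨_, hs, hsA, hsB⟩

theorem exists_renyiSum_flatMix_ge {n : ℕ} (hn : 2 ≤ n) {α β c : ℝ} (hα : 0 < α) (hαβ : α < β)
    {Q : Fin n → ℝ} (hQ : Q ∈ renyiLevel n α c) :
    ∃ s ∈ Set.Icc (0 : ℝ) 1, renyiSum α (flatMix n (n : ℝ)⁻¹ s) = c ∧
      renyiSum β Q ≤ renyiSum β (flatMix n (n : ℝ)⁻¹ s) := by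
  obtain ⟨p, hp, hmax⟩ := (isCompact_renyiLevel hα c).exists_isMaxOn ⟨Q, hQ⟩
    (continuous_renyiSum (hα.trans hαβ)).continuousOn
  obtain ⟨q, hq, hanti, hqp⟩ := exists_antitone_mem_renyiLevel hp
  obtain ⟨s, hs, rfl⟩ := exists_eq_flatMix_inv hn hanti hq.1.1 hq.1.2 (by
    intro i j k hij hjk
    by_contra hne
    have hlt : q k < q j := lt_of_le_of_ne (hanti hjk.le) (Ne.symm hne)
    obtain ⟨x, y, z, hx, hy, hz, hsum, h1, h2⟩ :=
      exists_renyiKernel_add_gt hα hαβ (hanti hij.le) hlt (hq.1.1 k)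
    obtain ⟨r, hr, h3⟩ := exists_mem_renyiLevel_replace_three (β := β) hq hij hjk hx hy hz hsum h1
    have h4 : renyiSum β r ≤ renyiSum β p := hmax hr
    have h5 := hqp β
    linarith)
  exact ⟨s, hs, hq.2, (hqp β).symm ▸ hmax hQ⟩

theorem exists_renyiSum_flatMix_le {n : ℕ} (hn : 2 ≤ n) {α β c : ℝ} (hα : 0 < α) (hαβ : α < β)
    {Q : Fin n → ℝ} (hQ : Q ∈ renyiLevel n α c) :
    ∃ b ∈ Set.Icc (n : ℝ)⁻¹ 1, renyiSum α (flatMix n b 0) = c ∧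
      renyiSum β (flatMix n b 0) ≤ renyiSum β Q := by
  obtain ⟨p, hp, hmin⟩ := (isCompact_renyiLevel hα c).exists_isMinOn ⟨Q, hQ⟩
    (continuous_renyiSum (hα.trans hαβ)).continuousOn
  obtain ⟨q, hq, hanti, hqp⟩ := exists_antitone_mem_renyiLevel hp
  obtain ⟨b, hb, hb1, rfl⟩ := exists_eq_flatMix_zero hn hanti hq.1.1 hq.1.2 (by
    intro i j k hij hjk
    by_contra! hne
    have hlt : q j < q i := lt_of_le_of_ne (hanti hij.le) (Ne.symm hne.1)
    obtain ⟨x, y, z, hx, hy, hz, hsum, h1, h2⟩ :=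
      exists_renyiKernel_add_lt hα hαβ hlt (hanti hjk.le) ((hq.1.1 k).lt_of_ne' hne.2)
    obtain ⟨r, hr, h3⟩ := exists_mem_renyiLevel_replace_three (β := β) hq hij hjk hx hy hz hsum h1
    have h4 : renyiSum β p ≤ renyiSum β r := hmin hr
    have h5 := hqp β
    linarith)
  exact ⟨b, ⟨hb, hb1⟩, hq.2, (hqp β).symm ▸ hmin hQ⟩

/-- Below the parameter `b₀` where `flatMix n b₀ 0` lies on the level set, the level set meets the
family `flatMix` in a connected set. -/
theorem isPreconnected_flatMix_level {n : ℕ} (hn : 0 < n) {α c b₀ : ℝ} (hα : 0 < α)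
    (hb₀ : b₀ ∈ Set.Icc (n : ℝ)⁻¹ 1) (hc : renyiSum α (flatMix n b₀ 0) = c) :
    IsPreconnected {x : ℝ × ℝ | x ∈ Set.Icc (n : ℝ)⁻¹ b₀ ×ˢ Set.Icc (0 : ℝ) 1 ∧
      renyiSum α (flatMix n x.1 x.2) = c} := by
  have hn0 : (0 : ℝ) < n := by exact_mod_cast hn
  have hcont := continuous_renyiSum_flatMix hα n
  have hpos : ∀ b ∈ Set.Icc (n : ℝ)⁻¹ b₀, 0 < b ∧ b ≤ 1 ∧ 1 ≤ n * b := fun b hb =>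
    ⟨(inv_pos.2 hn0).trans_le hb.1, hb.2.trans hb₀.2, (inv_le_iff_one_le_mul₀' hn0).1 hb.1⟩
  refine isPreconnected_of_preconnected_fibers (a := (n : ℝ)⁻¹) (b := b₀)
    ((isCompact_Icc.prod isCompact_Icc).inter_right (isClosed_eq hcont continuous_const)) ?_ ?_
  · refine Set.Subset.antisymm ?_ fun b hb => ?_
    · rintro _ ⟨x, hx, rfl⟩
      exact hx.1.1
    · obtain ⟨h0, h1, hnb⟩ := hpos b hb
      obtain ⟨h0', h1', hnb'⟩ := hpos b₀ ⟨hb₀.1, le_rfl⟩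
      have hlow : renyiSum α (flatMix n b 0) ≤ c :=
        (renyiSum_flatMix_zero_mono hα h0 hb.2 hnb).trans hc.le
      have hhigh : c ≤ renyiSum α (flatMix n b 1) := by
        have hmono := renyiSum_flatMix_mono hα h0' h1' hnb' (Set.left_mem_Icc.2 zero_le_one)
          (Set.right_mem_Icc.2 zero_le_one) zero_le_one
        rw [flatMix_one b b₀]
        exact hc.ge.trans hmono
      have hcont' : Continuous fun s => renyiSum α (flatMix n b s) :=
        Continuous.comp (f := fun s : ℝ => (b, s)) hcont (by fun_prop)
      obtain ⟨s, hs, hsc⟩ := intermediate_value_Icc zero_le_one hcont'.continuousOn ⟨hlow, hhigh⟩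
      exact ⟨(b, s), ⟨⟨hb, hs⟩, hsc⟩, rfl⟩
  · intro b hb
    obtain ⟨h0, h1, hnb⟩ := hpos b hb
    have hmono := renyiSum_flatMix_mono hα h0 h1 hnb
    refine Set.OrdConnected.isPreconnected ⟨?_⟩
    rintro s ⟨⟨_, hs⟩, hsc⟩ s' ⟨⟨_, hs'⟩, hsc'⟩ r ⟨hsr, hrs⟩
    have hr : r ∈ Set.Icc (0 : ℝ) 1 := ⟨hs.1.trans hsr, hrs.trans hs'.2⟩
    exact ⟨⟨hb, hr⟩, le_antisymm ((hmono hr hs' hrs).trans hsc'.le)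
      (hsc.ge.trans (hmono hs hr hsr))⟩

theorem renyi_two_orders_matched_by_mixture
    (α₁ α₂ : ℝ) (hα₁ : 0 < α₁) (hα₁₂ : α₁ < α₂)
    (n : ℕ) (hn : 2 ≤ n)
    (Q : Fin n → ℝ) (hQ : ∀ i, 0 ≤ Q i) (hQs : ∑ i, Q i = 1) :
    ∃ m : ℕ, 2 ≤ m ∧ m ≤ n ∧ ∃ x y z : ℝ,
      0 ≤ x ∧ 0 ≤ y ∧ 0 ≤ z ∧ x + y + z = 1 ∧
      renyiH α₁ (fun i => x * unif n m i + y * unif n (m - 1) i + z * unif n 1 i)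
        = renyiH α₁ Q ∧
      renyiH α₂ (fun i => x * unif n m i + y * unif n (m - 1) i + z * unif n 1 i)
        = renyiH α₂ Q := by
  have hα₂ : 0 < α₂ := hα₁.trans hα₁₂
  have hn0 : (0 : ℝ) < n := by positivity
  have hQL : Q ∈ renyiLevel n α₁ (renyiSum α₁ Q) := ⟨⟨hQ, hQs⟩, rfl⟩
  obtain ⟨s, hs, hsα, hsβ⟩ := exists_renyiSum_flatMix_ge hn hα₁ hα₁₂ hQL
  obtain ⟨b₀, hb₀, hbα, hbβ⟩ := exists_renyiSum_flatMix_le hn hα₁ hα₁₂ hQL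
  obtain ⟨⟨b, t⟩, ⟨⟨hb, ht⟩, htα⟩, htβ⟩ :=
    (isPreconnected_flatMix_level (by omega) hα₁ hb₀ hbα).intermediate_value
      (a := (b₀, 0)) (b := ((n : ℝ)⁻¹, s))
      ⟨⟨⟨hb₀.1, le_rfl⟩, ⟨le_rfl, zero_le_one⟩⟩, hbα⟩ ⟨⟨⟨le_rfl, hb₀.1⟩, hs⟩, hsα⟩
      (continuous_renyiSum_flatMix hα₂ n).continuousOn ⟨hbβ, hsβ⟩
  obtain ⟨m, hm, hmn, x, y, z, hx, hy, hz, hxyz, hP⟩ :=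
    exists_flatMix_eq_unif hn ((inv_pos.2 hn0).trans_le hb.1) (hb.2.trans hb₀.2)
      ((inv_le_iff_one_le_mul₀' hn0).1 hb.1) ht
  refine ⟨m, hm, hmn, x, y, z, hx, hy, hz, hxyz, ?_, ?_⟩
  · rw [hP]
    exact renyiH_eq_of_renyiSum_eq hα₁ htα
  · rw [hP]
    exact renyiH_eq_of_renyiSum_eq hα₂ htβ
end
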